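/- arXiv:2401.17532 — 2 statements merged into one kernel-verified Lean document; each statement's English description precedes it below -/
import Mathlib

section
/- Let G be a connected simple graph on vertices {1,…,n}, n ≥ 2, with edge set E, which is regularly realizable in ℝ². Let (a₁,…,aₙ) ∈ ℝⁿ lie in the convex hull of the set {e₁,…,eₙ} ∪ {(2/3)e_i + (2/3)e_j : {i,j} ∈ E}, where e_i are the standard basis vectors. Then there exists a constant C > 0 such that for every ε ∈ (0,1) and all nonnegative measurable f₁,…,fₙ : ℝ² → [0,∞), Λ_G^ε(f₁,…,fₙ) ≤ C ∏_{i=1}^n ‖f_i‖_{L^{1/a_i}(ℝ²)} (with the convention L^{1/0} = L^∞). In particular Λ_G is uniformly L^p-improving. -/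
open MeasureTheory ENNReal NNReal

noncomputable section

/-- The distance map `F(x₁,…,xₙ) = (|x_i − x_j|)_{{i,j} ∈ E}` of a graph `G`,
as a map `(ℝ²)ⁿ → ℝ^{|E|}`. -/
def distMap {n : ℕ} (G : SimpleGraph (Fin n)) [Fintype G.edgeSet]
    (x : Fin n → EuclideanSpace ℝ (Fin 2)) : G.edgeSet → ℝ :=
  fun e => Sym2.lift ⟨fun i j => dist (x i) (x j), fun _ _ => dist_comm _ _⟩
    (e : Sym2 (Fin n))

/-- `G` is regularly realizable in `ℝ²`: the set `M = F⁻¹(𝟏)` is nonempty and at every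
point of `M` the map `F` is differentiable with surjective Fréchet derivative
(`𝟏` is a regular value of `F`). -/
def RegularlyRealizable {n : ℕ} (G : SimpleGraph (Fin n)) [Fintype G.edgeSet] : Prop :=
  (∃ x, distMap G x = fun _ => 1) ∧
  ∀ x, distMap G x = (fun _ => 1) →
    DifferentiableAt ℝ (distMap G) x ∧ Function.Surjective (fderiv ℝ (distMap G) x)

/-- The mollified circle (sphere) kernel `σ_ε(y) = (2ε)⁻¹ 1_{[1-ε,1+ε]}(|y|)`. -/
def mollSigma (d : ℕ) (ε : ℝ) (y : EuclideanSpace ℝ (Fin d)) : ℝ≥0∞ :=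
  if 1 - ε ≤ ‖y‖ ∧ ‖y‖ ≤ 1 + ε then ENNReal.ofReal (1 / (2 * ε)) else 0

open Classical in
/-- The `ε`-regularized multilinear form `Λ_G^ε` with the mollified circle kernel. -/
def lamEps {n : ℕ} (G : SimpleGraph (Fin n)) (ε : ℝ)
    (f : Fin n → EuclideanSpace ℝ (Fin 2) → ℝ≥0) : ℝ≥0∞ :=
  ∫⁻ x : Fin n → EuclideanSpace ℝ (Fin 2),
    (∏ i, ∏ j, if i < j ∧ G.Adj i j then mollSigma 2 ε (x i - x j) else 1) *
      ∏ i, (f i (x i) : ℝ≥0∞)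

/-- The `L^p` norm (`p ∈ [1,∞]`) of a nonnegative function on `ℝ^d`. -/
def nnLpNorm' {d : ℕ} (p : ℝ≥0∞) (f : EuclideanSpace ℝ (Fin d) → ℝ≥0) : ℝ≥0∞ :=
  eLpNorm (fun x => (f x : ℝ)) p volume

/-- The vertex set of exponents: the standard basis vectors `e_i` together with the
points `(2/3) e_i + (2/3) e_j` for edges `{i,j}` of `G`. -/
def cornerSet {n : ℕ} (G : SimpleGraph (Fin n)) : Set (Fin n → ℝ) :=
  (Set.range fun i => Pi.single i (1 : ℝ)) ∪
    {v | ∃ i j, G.Adj i j ∧ v = (2/3 : ℝ) • (Pi.single i 1 : Fin n → ℝ) + (2/3 : ℝ) • (Pi.single j 1 : Fin n → ℝ)}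

section

open Set

/-- Integrating a function of `|s|` over the line gives twice its integral over the half-line. -/
lemma lintegral_comp_abs_eq (g : ℝ → ℝ≥0∞) :
    ∫⁻ s, g |s| = 2 * ∫⁻ s in Ioi 0, g s := by
  have hpos : ∫⁻ s in Ioi (0 : ℝ), g |s| = ∫⁻ s in Ioi 0, g s :=
    setLIntegral_congr_fun measurableSet_Ioi fun s hs => by
      rw [abs_of_pos (mem_Ioi.1 hs)]
  have hneg : ∫⁻ s in Iic (0 : ℝ), g |s| = ∫⁻ s in Ioi 0, g |s| := by
    have h := (Measure.measurePreserving_neg (volume : Measure ℝ)).setLIntegral_comp_preimage_emb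
      (MeasurableEquiv.neg ℝ).measurableEmbedding (fun s => g |s|) (Iio (0 : ℝ))
    rw [setLIntegral_congr Iio_ae_eq_Iic.symm, ← h]
    simp
  calc ∫⁻ s, g |s| = (∫⁻ s in Iic 0, g |s|) + ∫⁻ s in Ioi 0, g |s| := by
        rw [← lintegral_add_compl _ (measurableSet_Iic (a := (0 : ℝ))), compl_Iic]
    _ = _ := by rw [hneg, hpos, two_mul]

/-- The radial majorant controlling the weight near one of its two singularities. -/
def singularMajorant (d s : ℝ) : ℝ := (s ^ (3 / 4 : ℝ))⁻¹ * ((max d s) ^ (3 / 4 : ℝ))⁻¹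

lemma lintegral_singularMajorant_le {d : ℝ} (hd : 0 < d) :
    ∫⁻ s, ENNReal.ofReal (singularMajorant d |s|) ≤ ENNReal.ofReal (12 * d ^ (-(1 / 2) : ℝ)) := by
  have hsmall : ∫⁻ s in Ioc 0 d, ENNReal.ofReal (singularMajorant d s)
      = ENNReal.ofReal (4 * d ^ (-(1 / 2) : ℝ)) := by
    have hintg : IntegrableOn (fun s : ℝ => s ^ (-(3 / 4) : ℝ) * d ^ (-(3 / 4) : ℝ)) (Ioc 0 d) := by
      have := (intervalIntegral.intervalIntegrable_rpow' (a := 0) (b := d)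
        (r := -(3 / 4)) (by norm_num)).mul_const (d ^ (-(3 / 4) : ℝ))
      exact (intervalIntegrable_iff_integrableOn_Ioc_of_le hd.le).1 this
    have hval : ∫ s in Ioc 0 d, s ^ (-(3 / 4) : ℝ) * d ^ (-(3 / 4) : ℝ)
        = 4 * d ^ (-(1 / 2) : ℝ) := by
      rw [← intervalIntegral.integral_of_le hd.le, intervalIntegral.integral_mul_const,
        integral_rpow (Or.inl (by norm_num))]
      rw [Real.zero_rpow (by norm_num), sub_zero, div_mul_eq_mul_div, ← Real.rpow_add hd]
      norm_num
      ring
    rw [← hval, ofReal_integral_eq_lintegral_ofReal hintg]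
    · refine setLIntegral_congr_fun measurableSet_Ioc fun s hs => ?_
      simp only [singularMajorant]
      rw [max_eq_left hs.2, Real.rpow_neg hs.1.le, Real.rpow_neg hd.le]
    · filter_upwards [ae_restrict_mem measurableSet_Ioc] with s hs
      have := hs.1.le
      positivity
  have hlarge : ∫⁻ s in Ioi d, ENNReal.ofReal (singularMajorant d s)
      = ENNReal.ofReal (2 * d ^ (-(1 / 2) : ℝ)) := by
    have hintg : IntegrableOn (fun s : ℝ => s ^ (-(3 / 2) : ℝ)) (Ioi d) :=
      integrableOn_Ioi_rpow_of_lt (by norm_num) hd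
    have hval : ∫ s in Ioi d, s ^ (-(3 / 2) : ℝ) = 2 * d ^ (-(1 / 2) : ℝ) := by
      rw [integral_Ioi_rpow_of_lt (by norm_num) hd]
      norm_num
      ring
    rw [← hval, ofReal_integral_eq_lintegral_ofReal hintg]
    · refine setLIntegral_congr_fun measurableSet_Ioi fun s hs => ?_
      have hs0 : 0 < s := hd.trans hs
      simp only [singularMajorant]
      rw [max_eq_right (le_of_lt hs), ← Real.rpow_neg hs0.le, ← Real.rpow_add hs0]
      norm_num
    · filter_upwards [ae_restrict_mem measurableSet_Ioi] with s hs
      have : 0 ≤ s := (hd.trans hs).le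
      positivity
  calc ∫⁻ s, ENNReal.ofReal (singularMajorant d |s|)
      ≤ 2 * ∫⁻ s in Ioi 0, ENNReal.ofReal (singularMajorant d s) :=
        (lintegral_comp_abs_eq fun s => ENNReal.ofReal (singularMajorant d s)).le
    _ ≤ 2 * ((∫⁻ s in Ioc 0 d, ENNReal.ofReal (singularMajorant d s))
          + ∫⁻ s in Ioi d, ENNReal.ofReal (singularMajorant d s)) := by
        rw [← Ioc_union_Ioi_eq_Ioi hd.le]
        gcongr
        exact lintegral_union_le _ _ _
    _ = _ := by
        rw [hsmall, hlarge, ← ENNReal.ofReal_add (by positivity) (by positivity),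
          ← ENNReal.ofReal_ofNat, ← ENNReal.ofReal_mul (by norm_num)]
        ring_nf

/-- The weight distributing a product of three values over the pair `{a, b}`. -/
def pairWeight (a b c : ℝ) : ℝ :=
  |a - b| ^ (3 / 2 : ℝ) * (|a - c| ^ (3 / 4 : ℝ))⁻¹ * (|b - c| ^ (3 / 4 : ℝ))⁻¹

lemma measurable_pairWeight :
    Measurable fun p : ℝ × ℝ × ℝ => ENNReal.ofReal (pairWeight p.1 p.2.1 p.2.2) := by
  unfold pairWeight
  fun_prop

lemma pairWeight_cyclic_prod {a b c : ℝ} (hab : a ≠ b) (hac : a ≠ c) (hbc : b ≠ c) :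
    pairWeight a b c * pairWeight b c a * pairWeight c a b = 1 := by
  have h1 : 0 < |a - b| := abs_pos.2 (sub_ne_zero.2 hab)
  have h2 : 0 < |a - c| := abs_pos.2 (sub_ne_zero.2 hac)
  have h3 : 0 < |b - c| := abs_pos.2 (sub_ne_zero.2 hbc)
  have key : ∀ x : ℝ, 0 < x → x ^ (3 / 2 : ℝ) = x ^ (3 / 4 : ℝ) * x ^ (3 / 4 : ℝ) := by
    intro x hx
    rw [← Real.rpow_add hx]; norm_num
  unfold pairWeight
  rw [abs_sub_comm b a, abs_sub_comm c a, abs_sub_comm c b, key _ h1, key _ h2, key _ h3]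
  have := Real.rpow_pos_of_pos h1 (3 / 4)
  have := Real.rpow_pos_of_pos h2 (3 / 4)
  have := Real.rpow_pos_of_pos h3 (3 / 4)
  field_simp

lemma pairWeight_le {a b : ℝ} (hab : a ≠ b) (c : ℝ) :
    pairWeight a b c ≤ |a - b| ^ (3 / 2 : ℝ) *
      (singularMajorant (|a - b| / 2) |c - a| + singularMajorant (|a - b| / 2) |c - b|) := by
  have h1 : 0 < |a - b| := abs_pos.2 (sub_ne_zero.2 hab)
  have hnn : ∀ s, 0 ≤ singularMajorant (|a - b| / 2) |s| := fun s => by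
    unfold singularMajorant; positivity
  have aux : ∀ x y : ℝ, |a - b| ≤ |x| + |y| → |x| ≤ |y| →
      (|x| ^ (3 / 4 : ℝ))⁻¹ * (|y| ^ (3 / 4 : ℝ))⁻¹ ≤ singularMajorant (|a - b| / 2) |x| := by
    intro x y hxy hle
    unfold singularMajorant
    have : max (|a - b| / 2) |x| ≤ |y| := max_le (by linarith) hle
    have : 0 < max (|a - b| / 2) |x| := lt_max_of_lt_left (by positivity)
    gcongr
  have tri : |a - b| ≤ |c - a| + |c - b| := by
    calc |a - b| = |(c - b) - (c - a)| := by ring_nf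
      _ ≤ _ := by rw [add_comm]; exact abs_sub _ _
  unfold pairWeight
  rw [mul_assoc, abs_sub_comm a c, abs_sub_comm b c]
  gcongr
  rcases le_total |c - a| |c - b| with h | h
  · exact (aux _ _ tri h).trans (le_add_of_nonneg_right (hnn _))
  · rw [mul_comm]
    exact (aux _ _ (by linarith) h).trans (le_add_of_nonneg_left (hnn _))

lemma lintegral_pairWeight_le (a b : ℝ) :
    ∫⁻ c, ENNReal.ofReal (pairWeight a b c) ≤ 48 * ENNReal.ofReal |a - b| := by
  rcases eq_or_ne a b with rfl | hab
  · simp [pairWeight, Real.zero_rpow]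
  have h1 : 0 < |a - b| := abs_pos.2 (sub_ne_zero.2 hab)
  set d := |a - b| / 2 with hd
  have hdpos : 0 < d := by positivity
  have hnn : ∀ s, 0 ≤ singularMajorant d |s| := fun s => by
    unfold singularMajorant; positivity
  have hmeas : Measurable fun s => ENNReal.ofReal (singularMajorant d |s|) := by
    unfold singularMajorant; fun_prop
  have hmeas' : Measurable fun c => ENNReal.ofReal (singularMajorant d |c - a|) :=
    hmeas.comp (measurable_id.sub_const a)
  calc ∫⁻ c, ENNReal.ofReal (pairWeight a b c)
      ≤ ∫⁻ c, ENNReal.ofReal (|a - b| ^ (3 / 2 : ℝ)) *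
        (ENNReal.ofReal (singularMajorant d |c - a|)
          + ENNReal.ofReal (singularMajorant d |c - b|)) := by
        refine lintegral_mono fun c => ?_
        rw [← ENNReal.ofReal_add (hnn _) (hnn _), ← ENNReal.ofReal_mul (by positivity)]
        exact ENNReal.ofReal_le_ofReal (pairWeight_le hab c)
    _ = ENNReal.ofReal (|a - b| ^ (3 / 2 : ℝ)) *
        ((∫⁻ s, ENNReal.ofReal (singularMajorant d |s|))
          + ∫⁻ s, ENNReal.ofReal (singularMajorant d |s|)) := by
        rw [lintegral_const_mul' _ _ ENNReal.ofReal_ne_top,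
          lintegral_add_left hmeas',
          lintegral_sub_right_eq_self (fun s => ENNReal.ofReal (singularMajorant d |s|)),
          lintegral_sub_right_eq_self (fun s => ENNReal.ofReal (singularMajorant d |s|))]
    _ ≤ ENNReal.ofReal (|a - b| ^ (3 / 2 : ℝ)) *
        (ENNReal.ofReal (12 * d ^ (-(1 / 2) : ℝ)) + ENNReal.ofReal (12 * d ^ (-(1 / 2) : ℝ))) := by
        gcongr <;> exact lintegral_singularMajorant_le hdpos
    _ ≤ _ := by
        rw [← ENNReal.ofReal_add (by positivity) (by positivity),
          ← ENNReal.ofReal_mul (by positivity), ← ENNReal.ofReal_ofNat,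
          ← ENNReal.ofReal_mul (by norm_num)]
        apply ENNReal.ofReal_le_ofReal
        have hle : d ^ (-(1 / 2) : ℝ) ≤ 2 * |a - b| ^ (-(1 / 2) : ℝ) := by
          rw [hd, Real.div_rpow h1.le (by norm_num), Real.rpow_neg (by norm_num : (0 : ℝ) ≤ 2),
            div_inv_eq_mul, mul_comm]
          gcongr
          calc (2 : ℝ) ^ (1 / 2 : ℝ) ≤ 2 ^ (1 : ℝ) :=
                Real.rpow_le_rpow_of_exponent_le (by norm_num) (by norm_num)
            _ = 2 := by norm_num
        have hmul : |a - b| ^ (3 / 2 : ℝ) * |a - b| ^ (-(1 / 2) : ℝ) = |a - b| := by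
          rw [← Real.rpow_add h1]; norm_num
        have hp : 0 ≤ |a - b| ^ (3 / 2 : ℝ) := by positivity
        nlinarith [mul_le_mul_of_nonneg_left hle hp]

/-- The interval over which a quarter of the unit circle is parametrized as a graph. -/
def arcInterval : Set ℝ := Icc (-(4 / 5)) (4 / 5)

/-- The graph parametrization of the upper arc of the unit circle. -/
def arcPoint (u : ℝ) : EuclideanSpace ℝ (Fin 2) := !₂[u, √(1 - u ^ 2)]

lemma measurable_arcPoint : Measurable arcPoint := by
  unfold arcPoint
  refine (Continuous.measurable ?_)
  refine (PiLp.continuous_toLp 2 _).comp (continuous_pi fun i => ?_)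
  fin_cases i <;> simp <;> fun_prop

lemma lintegral_plane (g : EuclideanSpace ℝ (Fin 2) → ℝ≥0∞) (hg : Measurable g) :
    ∫⁻ z, g z = ∫⁻ u : ℝ, ∫⁻ v : ℝ, g !₂[u, v] := by
  have hg' : Measurable fun y : Fin 2 → ℝ => g (WithLp.toLp 2 y) :=
    hg.comp (PiLp.volume_preserving_toLp (Fin 2)).measurable
  rw [← (PiLp.volume_preserving_toLp (Fin 2)).lintegral_comp hg,
    ← (volume_preserving_finTwoArrow ℝ).symm.lintegral_comp hg',
    Measure.volume_eq_prod, lintegral_prod]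
  · rfl
  · exact (hg'.comp (MeasurableEquiv.measurable _)).aemeasurable

lemma hasDerivAt_arc {u : ℝ} (hu : u ∈ arcInterval) :
    HasDerivAt (fun x : ℝ => √(1 - x ^ 2)) (-(u / √(1 - u ^ 2))) u := by
  have hpos : 1 - u ^ 2 ≠ 0 := by
    have := hu.1; have := hu.2
    nlinarith
  convert ((hasDerivAt_pow 2 u).const_sub 1).sqrt hpos using 1
  simp
  field_simp

lemma le_arc_slope_sub {a b : ℝ} (ha : a ∈ arcInterval) (hb : b ∈ arcInterval) (hab : a ≤ b) :
    b - a ≤ b / √(1 - b ^ 2) - a / √(1 - a ^ 2) := by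
  have hmono : ∀ x y : ℝ, 0 ≤ x → x ≤ y → y ≤ 4 / 5 →
      x / √(1 - x ^ 2) - x ≤ y / √(1 - y ^ 2) - y := by
    intro x y hx hxy hy
    have h1 : 0 < √(1 - y ^ 2) := Real.sqrt_pos.2 (by nlinarith)
    have h2 : √(1 - y ^ 2) ≤ √(1 - x ^ 2) := Real.sqrt_le_sqrt (by nlinarith)
    have h3 : √(1 - x ^ 2) ≤ 1 := Real.sqrt_le_one.2 (by nlinarith)
    have h4 : 1 / √(1 - x ^ 2) ≤ 1 / √(1 - y ^ 2) := one_div_le_one_div_of_le h1 h2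
    have h5 : 1 ≤ 1 / √(1 - x ^ 2) := by
      rw [le_div_iff₀ (h1.trans_le h2)]; linarith
    have := mul_le_mul hxy (sub_le_sub_right h4 1) (by linarith) (hx.trans hxy)
    rw [div_eq_mul_one_div x, div_eq_mul_one_div y]
    linarith
  have hnn : ∀ x : ℝ, 0 ≤ x → x ≤ 4 / 5 → 0 ≤ x / √(1 - x ^ 2) - x := by
    intro x h0 hx
    simpa using hmono 0 x le_rfl h0 hx
  have ha1 := ha.1; have ha2 := ha.2; have hb1 := hb.1; have hb2 := hb.2
  rcases le_total 0 a with h | h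
  · linarith [hmono a b h hab hb2]
  · have hneg := hnn (-a) (by linarith) (by linarith)
    rw [neg_sq, neg_div] at hneg
    rcases le_total 0 b with h' | h'
    · linarith [hnn b h' hb2]
    · have := hmono (-b) (-a) (by linarith) (by linarith) (by linarith)
      rw [neg_sq, neg_sq, neg_div, neg_div] at this
      linarith

lemma abs_sub_le_abs_arc_slope_sub {a b : ℝ} (ha : a ∈ arcInterval) (hb : b ∈ arcInterval) :
    |a - b| ≤ |(-(a / √(1 - a ^ 2))) - (-(b / √(1 - b ^ 2)))| := by
  rcases le_total a b with h | h
  · have := le_arc_slope_sub ha hb h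
    rw [abs_sub_comm, abs_of_nonneg (sub_nonneg.2 h)]
    exact (this.trans (le_of_eq (by ring))).trans (le_abs_self _)
  · have := le_arc_slope_sub hb ha h
    rw [abs_of_nonneg (sub_nonneg.2 h)]
    rw [abs_sub_comm]
    exact (this.trans (le_of_eq (by ring))).trans (le_abs_self _)

lemma lintegral_chord_le (G : ℝ → ℝ≥0∞) (h : ℝ) :
    ∫⁻ b in {b | b ∈ arcInterval ∧ b + h ∈ arcInterval},
      ENNReal.ofReal |h| * G (√(1 - (b + h) ^ 2) - √(1 - b ^ 2)) ≤ ∫⁻ v, G v := by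
  rcases eq_or_ne h 0 with rfl | hh
  · simp
  set s := {b | b ∈ arcInterval ∧ b + h ∈ arcInterval} with hs
  have hsI : s = Icc (-(4 / 5)) (4 / 5) ∩ Icc (-(4 / 5) - h) (4 / 5 - h) := by
    ext b
    simp only [hs, arcInterval, mem_ofPred_eq, mem_inter_iff, mem_Icc]
    constructor <;> rintro ⟨⟨h1, h2⟩, h3, h4⟩ <;> refine ⟨⟨?_, ?_⟩, ?_, ?_⟩ <;> linarith
  have hsm : MeasurableSet s := by
    rw [hsI]; exact measurableSet_Icc.inter measurableSet_Icc
  have hconv : OrdConnected s := by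
    rw [hsI]; exact ordConnected_Icc.inter ordConnected_Icc
  set ψ := fun b : ℝ => √(1 - (b + h) ^ 2) - √(1 - b ^ 2)
  set ψ' := fun b : ℝ => -((b + h) / √(1 - (b + h) ^ 2)) - -(b / √(1 - b ^ 2))
  have hder : ∀ b ∈ s, HasDerivAt ψ (ψ' b) b := fun b hb =>
    ((hasDerivAt_arc hb.2).comp_add_const b h).sub (hasDerivAt_arc hb.1)
  have hlow : ∀ b ∈ s, |h| ≤ |ψ' b| := fun b hb => by
    have := abs_sub_le_abs_arc_slope_sub hb.2 hb.1
    rwa [add_sub_cancel_left] at this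
  have hinj : InjOn ψ s := by
    have key : ∀ x ∈ s, ∀ y ∈ s, x < y → ψ x ≠ ψ y := by
      intro x hx y hy hxy heq
      obtain ⟨c, hc, hc0⟩ := exists_hasDerivAt_eq_zero (f' := ψ') hxy
        (fun b hb => (hder b (hconv.out hx hy hb)).continuousAt.continuousWithinAt) heq
        (fun b hb => hder b (hconv.out hx hy (Ioo_subset_Icc_self hb)))
      have := hlow c (hconv.out hx hy (Ioo_subset_Icc_self hc))
      rw [hc0, abs_zero] at this
      exact hh (abs_nonpos_iff.1 this)
    intro x hx y hy heq
    by_contra hne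
    rcases lt_or_gt_of_ne hne with h' | h'
    · exact key x hx y hy h' heq
    · exact key y hy x hx h' heq.symm
  calc ∫⁻ b in s, ENNReal.ofReal |h| * G (ψ b)
      ≤ ∫⁻ b in s, ENNReal.ofReal |ψ' b| * G (ψ b) := by
        refine setLIntegral_mono' hsm fun b hb => ?_
        exact mul_le_mul' (ENNReal.ofReal_le_ofReal (hlow b hb)) le_rfl
    _ = ∫⁻ v in ψ '' s, G v :=
        (lintegral_image_eq_lintegral_abs_deriv_mul hsm
          (fun b hb => (hder b hb).hasDerivWithinAt) hinj G).symm
    _ ≤ ∫⁻ v, G v := setLIntegral_le_lintegral _ _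

lemma lintegral_arc_diff_le (G : EuclideanSpace ℝ (Fin 2) → ℝ≥0∞) (hG : Measurable G) :
    ∫⁻ b in arcInterval, ∫⁻ a in arcInterval,
      ENNReal.ofReal |a - b| * G (arcPoint a - arcPoint b) ≤ ∫⁻ z, G z := by
  have hI : MeasurableSet arcInterval := measurableSet_Icc
  have hma := measurable_arcPoint
  calc ∫⁻ b in arcInterval, ∫⁻ a in arcInterval,
        ENNReal.ofReal |a - b| * G (arcPoint a - arcPoint b)
      = ∫⁻ b : ℝ, ∫⁻ h : ℝ, arcInterval.indicator 1 b * (arcInterval.indicator 1 (b + h) *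
          (ENNReal.ofReal |h| * G (arcPoint (b + h) - arcPoint b))) := by
        rw [← lintegral_indicator hI]
        refine lintegral_congr fun b => ?_
        by_cases hb : b ∈ arcInterval
        · simp only [indicator_of_mem hb, Pi.one_apply, one_mul]
          rw [← lintegral_indicator hI, ← lintegral_add_left_eq_self _ b]
          refine lintegral_congr fun h => ?_
          by_cases hbh : b + h ∈ arcInterval <;> simp [hbh]
        · simp [hb]
    _ = ∫⁻ h : ℝ, ∫⁻ b : ℝ, arcInterval.indicator 1 b * (arcInterval.indicator 1 (b + h) *
          (ENNReal.ofReal |h| * G (arcPoint (b + h) - arcPoint b))) := by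
        refine lintegral_lintegral_swap (Measurable.aemeasurable ?_)
        have h1 : Measurable (arcInterval.indicator (1 : ℝ → ℝ≥0∞)) :=
          measurable_one.indicator hI
        simp only [Function.uncurry_def]
        fun_prop
    _ ≤ ∫⁻ h : ℝ, ∫⁻ v : ℝ, G !₂[h, v] := by
        refine lintegral_mono fun h => ?_
        refine le_trans (le_of_eq ?_) (lintegral_chord_le (fun v => G !₂[h, v]) h)
        rw [← lintegral_indicator]
        · refine lintegral_congr fun b => ?_
          have : arcPoint (b + h) - arcPoint b = !₂[h, √(1 - (b + h) ^ 2) - √(1 - b ^ 2)] := by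
            ext i
            fin_cases i <;> simp [arcPoint]
          rw [this]
          by_cases hb : b ∈ arcInterval <;> by_cases hbh : b + h ∈ arcInterval <;> simp [hb, hbh]
        · exact hI.inter (hI.preimage (measurable_add_const h))
    _ = ∫⁻ z, G z := (lintegral_plane G hG).symm

/-- A product of three numbers is dominated by the sum of weighted pair products. -/
lemma mul_mul_le_sum_pairs {x y z u v w : ℝ≥0∞} (huvw : u * v * w = 1) :
    x * y * z ≤ u * (x ^ (3 / 2 : ℝ) * y ^ (3 / 2 : ℝ)) + v * (y ^ (3 / 2 : ℝ) * z ^ (3 / 2 : ℝ))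
      + w * (z ^ (3 / 2 : ℝ) * x ^ (3 / 2 : ℝ)) := by
  have key : ∀ t : ℝ≥0∞, t ^ (3 / 2 : ℝ) * t ^ (3 / 2 : ℝ) = t ^ 3 := by
    intro t
    rw [← ENNReal.rpow_add_of_nonneg _ _ (by norm_num) (by norm_num), ← ENNReal.rpow_natCast]
    norm_num
  set A := u * (x ^ (3 / 2 : ℝ) * y ^ (3 / 2 : ℝ)) with hA
  set B := v * (y ^ (3 / 2 : ℝ) * z ^ (3 / 2 : ℝ)) with hB
  set D := w * (z ^ (3 / 2 : ℝ) * x ^ (3 / 2 : ℝ)) with hD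
  have hprod : A * B * D = (x * y * z) ^ 3 := by
    calc A * B * D = (u * v * w) * (x ^ (3 / 2 : ℝ) * x ^ (3 / 2 : ℝ))
          * (y ^ (3 / 2 : ℝ) * y ^ (3 / 2 : ℝ)) * (z ^ (3 / 2 : ℝ) * z ^ (3 / 2 : ℝ)) := by
          rw [hA, hB, hD]; ring
      _ = _ := by rw [huvw, key, key, key]; ring
  refine (ENNReal.pow_le_pow_left_iff three_ne_zero).1 ?_
  rw [← hprod]
  have h1 : A ≤ A + B + D := le_add_right le_self_add
  have h2 : B ≤ A + B + D := le_add_right le_add_self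
  have h3 : D ≤ A + B + D := le_add_self
  calc A * B * D ≤ (A + B + D) * (A + B + D) * (A + B + D) := mul_le_mul' (mul_le_mul' h1 h2) h3
    _ = (A + B + D) ^ 3 := by ring

lemma ofReal_pairWeight_cyclic {a b c : ℝ} (hab : a ≠ b) (hac : a ≠ c) (hbc : b ≠ c) :
    ENNReal.ofReal (pairWeight a b c) * ENNReal.ofReal (pairWeight b c a)
      * ENNReal.ofReal (pairWeight c a b) = 1 := by
  have hnn : ∀ a b c, 0 ≤ pairWeight a b c := fun a b c => by unfold pairWeight; positivity
  rw [← ENNReal.ofReal_mul (hnn _ _ _), ← ENNReal.ofReal_mul (mul_nonneg (hnn _ _ _) (hnn _ _ _)),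
    pairWeight_cyclic_prod hab hac hbc, ENNReal.ofReal_one]

/-- Each cyclic rearrangement of the arguments has the same triple integral. -/
lemma lintegral_cyclic_sum (μ : Measure ℝ) [SFinite μ] {T : ℝ → ℝ → ℝ → ℝ≥0∞}
    (hT : Measurable fun p : ℝ × ℝ × ℝ => T p.1 p.2.1 p.2.2) :
    ∫⁻ b, ∫⁻ a, ∫⁻ c, (T a b c + T b c a + T c a b) ∂μ ∂μ ∂μ
      = 3 * ∫⁻ b, ∫⁻ a, ∫⁻ c, T a b c ∂μ ∂μ ∂μ := by
  have hinner : ∀ {S : ℝ → ℝ → ℝ → ℝ≥0∞}, (Measurable fun p : ℝ × ℝ × ℝ => S p.1 p.2.1 p.2.2) →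
      ∫⁻ x, ∫⁻ y, ∫⁻ z, S x y z ∂μ ∂μ ∂μ = ∫⁻ x, ∫⁻ z, ∫⁻ y, S x y z ∂μ ∂μ ∂μ := by
    intro S hS
    refine lintegral_congr fun x => lintegral_lintegral_swap (Measurable.aemeasurable ?_)
    exact hS.comp (by fun_prop : Measurable fun p : ℝ × ℝ => (x, p.1, p.2))
  have houter : ∀ {S : ℝ → ℝ → ℝ → ℝ≥0∞}, (Measurable fun p : ℝ × ℝ × ℝ => S p.1 p.2.1 p.2.2) →
      ∫⁻ x, ∫⁻ y, ∫⁻ z, S x y z ∂μ ∂μ ∂μ = ∫⁻ y, ∫⁻ x, ∫⁻ z, S x y z ∂μ ∂μ ∂μ := by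
    intro S hS
    refine lintegral_lintegral_swap (Measurable.aemeasurable ?_)
    exact Measurable.lintegral_prod_right' (f := fun q : (ℝ × ℝ) × ℝ => S q.1.1 q.1.2 q.2)
      (hS.comp (by fun_prop : Measurable fun q : (ℝ × ℝ) × ℝ => (q.1.1, q.1.2, q.2)))
  have h1 : Measurable fun p : ℝ × ℝ × ℝ => T p.2.1 p.1 p.2.2 :=
    hT.comp (by fun_prop : Measurable fun p : ℝ × ℝ × ℝ => (p.2.1, p.1, p.2.2))
  have h2 : Measurable fun p : ℝ × ℝ × ℝ => T p.1 p.2.2 p.2.1 :=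
    hT.comp (by fun_prop : Measurable fun p : ℝ × ℝ × ℝ => (p.1, p.2.2, p.2.1))
  have h3 : Measurable fun p : ℝ × ℝ × ℝ => T p.2.2 p.2.1 p.1 :=
    hT.comp (by fun_prop : Measurable fun p : ℝ × ℝ × ℝ => (p.2.2, p.2.1, p.1))
  have h4 : Measurable fun p : ℝ × ℝ × ℝ => T p.2.1 p.2.2 p.1 :=
    hT.comp (by fun_prop : Measurable fun p : ℝ × ℝ × ℝ => (p.2.1, p.2.2, p.1))
  have hadd : ∀ {S R : ℝ → ℝ → ℝ → ℝ≥0∞}, (Measurable fun p : ℝ × ℝ × ℝ => S p.1 p.2.1 p.2.2) →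
      ∫⁻ x, ∫⁻ y, ∫⁻ z, (S x y z + R x y z) ∂μ ∂μ ∂μ
        = (∫⁻ x, ∫⁻ y, ∫⁻ z, S x y z ∂μ ∂μ ∂μ) + ∫⁻ x, ∫⁻ y, ∫⁻ z, R x y z ∂μ ∂μ ∂μ := by
    intro S R hS
    have hS' : Measurable fun p : ℝ × ℝ => ∫⁻ z, S p.1 p.2 z ∂μ :=
      Measurable.lintegral_prod_right' (f := fun q : (ℝ × ℝ) × ℝ => S q.1.1 q.1.2 q.2)
        (hS.comp (by fun_prop : Measurable fun q : (ℝ × ℝ) × ℝ => (q.1.1, q.1.2, q.2)))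
    rw [← lintegral_add_left hS'.lintegral_prod_right']
    refine lintegral_congr fun x => ?_
    have hx : Measurable fun y => ∫⁻ z, S x y z ∂μ :=
      hS'.comp (by fun_prop : Measurable fun y : ℝ => (x, y))
    rw [← lintegral_add_left hx]
    refine lintegral_congr fun y => ?_
    have hxy : Measurable fun z => S x y z :=
      hS.comp (by fun_prop : Measurable fun z : ℝ => (x, y, z))
    rw [← lintegral_add_left hxy]
  have e1 : ∫⁻ b, ∫⁻ a, ∫⁻ c, T a b c ∂μ ∂μ ∂μ = ∫⁻ x, ∫⁻ y, ∫⁻ z, T x y z ∂μ ∂μ ∂μ :=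
    (houter hT).symm
  have e2 : ∫⁻ b, ∫⁻ a, ∫⁻ c, T b c a ∂μ ∂μ ∂μ = ∫⁻ x, ∫⁻ y, ∫⁻ z, T x y z ∂μ ∂μ ∂μ :=
    (hinner hT).symm
  have e3 : ∫⁻ b, ∫⁻ a, ∫⁻ c, T c a b ∂μ ∂μ ∂μ = ∫⁻ x, ∫⁻ y, ∫⁻ z, T x y z ∂μ ∂μ ∂μ := by
    rw [hinner h3, houter h4, hinner h2]
  rw [hadd (S := fun b a c => T a b c + T b c a) (h1.add h2), hadd h1, e1, e2, e3]
  ring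

lemma lintegral_cube_le {μ : Measure ℝ} [SFinite μ] (hμ : μ ≤ volume)
    {F : ℝ → ℝ≥0∞} (hF : Measurable F) :
    (∫⁻ a, F a ∂μ) ^ 3 ≤ 144 * ∫⁻ b, ∫⁻ a,
      ENNReal.ofReal |a - b| * (F a ^ (3 / 2 : ℝ) * F b ^ (3 / 2 : ℝ)) ∂μ ∂μ := by
  set T := fun a b c : ℝ => ENNReal.ofReal (pairWeight a b c)
    * (F a ^ (3 / 2 : ℝ) * F b ^ (3 / 2 : ℝ)) with hT
  have hw := measurable_pairWeight
  have hTm : Measurable fun p : ℝ × ℝ × ℝ => T p.1 p.2.1 p.2.2 := by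
    simp only [hT]; fun_prop
  have hbound : ∫⁻ b, ∫⁻ a, ∫⁻ c, T a b c ∂μ ∂μ ∂μ ≤ 48 * ∫⁻ b, ∫⁻ a,
      ENNReal.ofReal |a - b| * (F a ^ (3 / 2 : ℝ) * F b ^ (3 / 2 : ℝ)) ∂μ ∂μ := by
    rw [← lintegral_const_mul' _ _ (by norm_num)]
    refine lintegral_mono fun b => ?_
    rw [← lintegral_const_mul' _ _ (by norm_num)]
    refine lintegral_mono fun a => ?_
    have hwab : Measurable fun c => ENNReal.ofReal (pairWeight a b c) :=
      by unfold pairWeight; fun_prop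
    simp only [hT]
    rw [lintegral_mul_const _ hwab, ← mul_assoc 48]
    refine mul_le_mul' ?_ le_rfl
    exact (lintegral_mono' hμ le_rfl).trans (lintegral_pairWeight_le a b)
  have hne : ∀ a : ℝ, ∀ᵐ b ∂μ, a ≠ b := fun a =>
    ae_mono hμ (by
      have := (measure_eq_zero_iff_ae_notMem (μ := (volume : Measure ℝ))).1
        (measure_singleton (μ := volume) a)
      filter_upwards [this] with b hb h
      exact hb (by simp [h]))
  have hsum : (∫⁻ a, F a ∂μ) ^ 3 ≤ ∫⁻ b, ∫⁻ a, ∫⁻ c, (T a b c + T b c a + T c a b) ∂μ ∂μ ∂μ := by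
    have : (∫⁻ a, F a ∂μ) ^ 3 = ∫⁻ b, ∫⁻ a, ∫⁻ c, F a * F b * F c ∂μ ∂μ ∂μ := by
      simp_rw [lintegral_const_mul _ hF, mul_assoc, lintegral_mul_const _ hF]
      rw [lintegral_const_mul _ (hF.mul_const _), lintegral_mul_const _ hF, pow_three]
    rw [this]
    refine lintegral_mono fun b => ?_
    refine lintegral_mono_ae ?_
    filter_upwards [hne b] with a ha
    refine lintegral_mono_ae ?_
    filter_upwards [hne a, hne b] with c hac hbc
    exact mul_mul_le_sum_pairs (ofReal_pairWeight_cyclic ha.symm hac hbc)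
  have hsplit := lintegral_cyclic_sum μ hTm
  calc (∫⁻ a, F a ∂μ) ^ 3 ≤ _ := hsum
    _ = 3 * ∫⁻ b, ∫⁻ a, ∫⁻ c, T a b c ∂μ ∂μ ∂μ := hsplit
    _ ≤ 3 * (48 * ∫⁻ b, ∫⁻ a,
      ENNReal.ofReal |a - b| * (F a ^ (3 / 2 : ℝ) * F b ^ (3 / 2 : ℝ)) ∂μ ∂μ) := by gcongr
    _ = _ := by rw [← mul_assoc]; norm_num

/-- Averaging over the arc improves `L^{3/2}` to `L³`. -/
lemma lintegral_arc_average_cube_le {f : EuclideanSpace ℝ (Fin 2) → ℝ≥0∞} (hf : Measurable f) :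
    ∫⁻ y, (∫⁻ u in arcInterval, f (y + arcPoint u)) ^ 3
      ≤ 144 * (∫⁻ y, f y ^ (3 / 2 : ℝ)) ^ 2 := by
  have hma := measurable_arcPoint
  set g := fun y => f y ^ (3 / 2 : ℝ) with hg
  have hgm : Measurable g := hf.pow_const _
  set μ := (volume : Measure ℝ).restrict arcInterval with hμ
  have hμle : μ ≤ volume := Measure.restrict_le_self
  calc ∫⁻ y, (∫⁻ u, f (y + arcPoint u) ∂μ) ^ 3
      ≤ ∫⁻ y, 144 * ∫⁻ b, ∫⁻ a, ENNReal.ofReal |a - b| *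
          (g (y + arcPoint a) * g (y + arcPoint b)) ∂μ ∂μ :=
        lintegral_mono fun y => lintegral_cube_le hμle (by fun_prop)
    _ = 144 * ∫⁻ b, ∫⁻ y, ∫⁻ a, ENNReal.ofReal |a - b| *
          (g (y + arcPoint a) * g (y + arcPoint b)) ∂μ ∂volume ∂μ := by
        rw [lintegral_const_mul' _ _ (by norm_num), lintegral_lintegral_swap]
        refine Measurable.aemeasurable ?_
        exact Measurable.lintegral_prod_right'
          (f := fun q : (EuclideanSpace ℝ (Fin 2) × ℝ) × ℝ => ENNReal.ofReal |q.2 - q.1.2| *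
            (g (q.1.1 + arcPoint q.2) * g (q.1.1 + arcPoint q.1.2))) (by fun_prop)
    _ = 144 * ∫⁻ b, ∫⁻ y, ∫⁻ a, ENNReal.ofReal |a - b| *
          (g (y + (arcPoint a - arcPoint b)) * g y) ∂μ ∂volume ∂μ := by
        congr 1
        refine lintegral_congr fun b => ?_
        rw [← lintegral_add_right_eq_self _ (-arcPoint b)]
        simp only [add_assoc, sub_eq_add_neg, add_comm (-arcPoint b)]
        simp
    _ = 144 * ∫⁻ y, ∫⁻ b, ∫⁻ a, ENNReal.ofReal |a - b| *
          (g (y + (arcPoint a - arcPoint b)) * g y) ∂μ ∂μ := by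
        congr 1
        refine lintegral_lintegral_swap (Measurable.aemeasurable ?_)
        exact Measurable.lintegral_prod_right'
          (f := fun q : (ℝ × EuclideanSpace ℝ (Fin 2)) × ℝ => ENNReal.ofReal |q.2 - q.1.1| *
            (g (q.1.2 + (arcPoint q.2 - arcPoint q.1.1)) * g q.1.2)) (by fun_prop)
    _ = 144 * ∫⁻ y, (∫⁻ b, ∫⁻ a, ENNReal.ofReal |a - b| *
          g (y + (arcPoint a - arcPoint b)) ∂μ ∂μ) * g y := by
        congr 1
        refine lintegral_congr fun y => ?_
        rw [← lintegral_mul_const]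
        · refine lintegral_congr fun b => ?_
          rw [← lintegral_mul_const _ (by fun_prop)]
          simp only [mul_assoc]
        · exact Measurable.lintegral_prod_right' (f := fun q : ℝ × ℝ => ENNReal.ofReal |q.2 - q.1| *
            g (y + (arcPoint q.2 - arcPoint q.1))) (by fun_prop)
    _ ≤ 144 * ∫⁻ y, (∫⁻ z, g z) * g y := by
        gcongr with y
        refine (lintegral_arc_diff_le (fun z => g (y + z)) (by fun_prop)).trans ?_
        rw [lintegral_add_left_eq_self]
    _ = 144 * (∫⁻ y, g y) ^ 2 := by
        rw [lintegral_const_mul _ hgm, sq]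

/-- A convolution kernel is bounded by `B` on `L^{3/2} × L^{3/2}`. -/
def IsPairBound (k : EuclideanSpace ℝ (Fin 2) → ℝ≥0∞) (B : ℝ≥0∞) : Prop :=
  ∀ f g : EuclideanSpace ℝ (Fin 2) → ℝ≥0∞, Measurable f → Measurable g →
    ∫⁻ x, ∫⁻ y, k (x - y) * (f x * g y) ≤
      B * ((∫⁻ x, f x ^ (3 / 2 : ℝ)) ^ (2 / 3 : ℝ) * (∫⁻ x, g x ^ (3 / 2 : ℝ)) ^ (2 / 3 : ℝ))

lemma IsPairBound.mono {k l : EuclideanSpace ℝ (Fin 2) → ℝ≥0∞} {B D : ℝ≥0∞}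
    (h : IsPairBound k B) (hl : ∀ z, l z ≤ k z) (hBD : B ≤ D) : IsPairBound l D := by
  intro f g hf hg
  refine le_trans ?_ ((h f g hf hg).trans (by gcongr))
  gcongr
  exact hl _

lemma IsPairBound.add {k l : EuclideanSpace ℝ (Fin 2) → ℝ≥0∞} {B D : ℝ≥0∞} (hkm : Measurable k)
    (hk : IsPairBound k B) (hl : IsPairBound l D) : IsPairBound (k + l) (B + D) := by
  intro f g hf hg
  rw [add_mul B]
  refine le_trans (le_of_eq ?_) (add_le_add (hk f g hf hg) (hl f g hf hg))
  rw [← lintegral_add_left]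
  · refine lintegral_congr fun x => ?_
    rw [← lintegral_add_left (by fun_prop)]
    simp only [Pi.add_apply, add_mul]
  · exact Measurable.lintegral_prod_right' (f := fun q : EuclideanSpace ℝ (Fin 2) ×
      EuclideanSpace ℝ (Fin 2) => k (q.1 - q.2) * (f q.1 * g q.2)) (by fun_prop)

lemma IsPairBound.const_mul {k : EuclideanSpace ℝ (Fin 2) → ℝ≥0∞} {B : ℝ≥0∞}
    (hk : IsPairBound k B) {r : ℝ≥0∞} (hr : r ≠ ∞) : IsPairBound (fun z => r * k z) (r * B) := by
  intro f g hf hg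
  rw [mul_assoc]
  refine le_trans (le_of_eq ?_) (mul_le_mul_right (hk f g hf hg) r)
  rw [← lintegral_const_mul' _ _ hr]
  refine lintegral_congr fun x => ?_
  rw [← lintegral_const_mul' _ _ hr]
  simp only [mul_assoc]

lemma IsPairBound.comp_isometry {k : EuclideanSpace ℝ (Fin 2) → ℝ≥0∞} {B : ℝ≥0∞}
    (hkm : Measurable k) (hk : IsPairBound k B)
    (T : EuclideanSpace ℝ (Fin 2) ≃ₗᵢ[ℝ] EuclideanSpace ℝ (Fin 2)) :
    IsPairBound (fun z => k (T z)) B := by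
  intro f g hf hg
  have hT := T.measurePreserving
  have hTs := T.symm.measurePreserving
  have hf' : Measurable fun x => f (T.symm x) := hf.comp hTs.measurable
  have hg' : Measurable fun x => g (T.symm x) := hg.comp hTs.measurable
  have key := hk _ _ hf' hg'
  rw [hTs.lintegral_comp (hf.pow_const (3 / 2 : ℝ)),
    hTs.lintegral_comp (hg.pow_const (3 / 2 : ℝ))] at key
  refine le_trans (le_of_eq ?_) key
  have hm : Measurable fun q : EuclideanSpace ℝ (Fin 2) × EuclideanSpace ℝ (Fin 2) =>
      k (q.1 - q.2) * (f (T.symm q.1) * g (T.symm q.2)) := by fun_prop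
  refine Eq.trans (lintegral_congr fun x => ?_) (hT.lintegral_comp hm.lintegral_prod_right')
  refine Eq.trans (lintegral_congr fun y => ?_)
    (hT.lintegral_comp (hm.comp (measurable_prodMk_left (x := T x))))
  simp

lemma IsPairBound.translate {k : EuclideanSpace ℝ (Fin 2) → ℝ≥0∞} {B : ℝ≥0∞}
    (hk : IsPairBound k B) (c : EuclideanSpace ℝ (Fin 2)) :
    IsPairBound (fun z => k (z + c)) B := by
  intro f g hf hg
  have key := hk (fun x => f (x - c)) g (by fun_prop) hg
  rw [lintegral_sub_right_eq_self fun x => f x ^ (3 / 2 : ℝ)] at key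
  refine le_trans (le_of_eq ?_) key
  rw [← lintegral_sub_right_eq_self _ c]
  refine lintegral_congr fun x => ?_
  simp only [sub_add_cancel, sub_add_eq_add_sub]

/-- The vertical `ρ`-neighbourhood of the arc. -/
def arcStrip (ρ : ℝ) : Set (EuclideanSpace ℝ (Fin 2)) :=
  {z | z 0 ∈ arcInterval ∧ |z 1 - √(1 - z 0 ^ 2)| ≤ ρ}

lemma measurableSet_arcStrip (ρ : ℝ) : MeasurableSet (arcStrip ρ) := by
  have h : arcStrip ρ = (fun z : EuclideanSpace ℝ (Fin 2) => z 0) ⁻¹' arcInterval ∩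
      {z | |z 1 - √(1 - z 0 ^ 2)| ≤ ρ} := rfl
  rw [h]
  refine MeasurableSet.inter ?_ ?_
  · exact (by fun_prop : Measurable fun z : EuclideanSpace ℝ (Fin 2) => z 0) measurableSet_Icc
  · exact measurableSet_le (by fun_prop) (by fun_prop)

lemma measurable_vertical :
    Measurable fun s : ℝ => (!₂[0, s] : EuclideanSpace ℝ (Fin 2)) := by
  refine (PiLp.continuous_toLp 2 _).measurable.comp (measurable_pi_iff.2 fun i => ?_)
  fin_cases i
  · exact measurable_const
  · exact measurable_id

lemma lintegral_arcStrip (ρ : ℝ) {f : EuclideanSpace ℝ (Fin 2) → ℝ≥0∞} (hf : Measurable f) :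
    ∫⁻ z, (arcStrip ρ).indicator 1 z * f z =
      ∫⁻ s in Icc (-ρ) ρ, ∫⁻ u in arcInterval, f (!₂[0, s] + arcPoint u) := by
  have hma := measurable_arcPoint
  have hms := measurableSet_arcStrip ρ
  have hv := measurable_vertical
  rw [lintegral_plane (fun z => (arcStrip ρ).indicator 1 z * f z)
    ((measurable_one.indicator hms).mul hf)]
  rw [lintegral_lintegral_swap (μ := volume.restrict (Icc (-ρ) ρ)) (by fun_prop),
    ← lintegral_indicator (s := arcInterval) measurableSet_Icc]
  refine lintegral_congr fun u => ?_
  by_cases hu : u ∈ arcInterval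
  · rw [indicator_of_mem hu, ← lintegral_indicator measurableSet_Icc,
      ← lintegral_add_right_eq_self _ (√(1 - u ^ 2))]
    refine lintegral_congr fun s => ?_
    have hmem : !₂[u, s + √(1 - u ^ 2)] ∈ arcStrip ρ ↔ s ∈ Icc (-ρ) ρ := by
      simp only [arcStrip, mem_ofPred_eq, Matrix.cons_val_zero, hu,
        Matrix.cons_val_one, add_sub_cancel_right, true_and, abs_le, mem_Icc]
    have hpt : !₂[0, s] + arcPoint u = !₂[u, s + √(1 - u ^ 2)] := by
      ext i
      fin_cases i <;> simp [arcPoint]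
    by_cases hs : s ∈ Icc (-ρ) ρ
    · rw [indicator_of_mem (hmem.2 hs), indicator_of_mem hs, hpt, Pi.one_apply, one_mul]
    · rw [indicator_of_notMem (hmem.not.2 hs), indicator_of_notMem hs, zero_mul]
  · rw [indicator_of_notMem hu]
    refine lintegral_eq_zero_of_ae_eq_zero (ae_of_all _ fun v => ?_)
    have : !₂[u, v] ∉ arcStrip ρ := by simp [arcStrip, hu]
    simp [indicator_of_notMem this]

lemma isPairBound_arcStrip (ρ : ℝ) :
    IsPairBound ((arcStrip ρ).indicator 1) (ENNReal.ofReal (12 * ρ)) := by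
  intro f g hf hg
  have hma := measurable_arcPoint
  have hms := measurableSet_arcStrip ρ
  have hv := measurable_vertical
  have hk : Measurable ((arcStrip ρ).indicator (1 : EuclideanSpace ℝ (Fin 2) → ℝ≥0∞)) :=
    measurable_one.indicator hms
  set Nf := (∫⁻ x, f x ^ (3 / 2 : ℝ)) ^ (2 / 3 : ℝ)
  set Ng := (∫⁻ x, g x ^ (3 / 2 : ℝ)) ^ (2 / 3 : ℝ)
  have hslice : ∀ w : EuclideanSpace ℝ (Fin 2),
      ∫⁻ y, g y * ∫⁻ u in arcInterval, f (y + w + arcPoint u) ≤ 6 * (Nf * Ng) := by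
    intro w
    have hA : Measurable fun y => ∫⁻ u in arcInterval, f (y + arcPoint u) :=
      Measurable.lintegral_prod_right' (f := fun q : EuclideanSpace ℝ (Fin 2) × ℝ =>
        f (q.1 + arcPoint q.2)) (by fun_prop)
    have h := ENNReal.lintegral_mul_le_Lp_mul_Lq volume (p := 3 / 2) (q := 3)
      (by constructor <;> norm_num) hg.aemeasurable (hA.comp (measurable_add_const w)).aemeasurable
    refine h.trans ?_
    simp only [Function.comp_apply]
    rw [lintegral_add_right_eq_self (fun y => (∫⁻ u in arcInterval, f (y + arcPoint u)) ^ (3 : ℝ))]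
    have hcube : (∫⁻ y, (∫⁻ u in arcInterval, f (y + arcPoint u)) ^ (3 : ℝ)) ^ (1 / 3 : ℝ)
        ≤ 6 * Nf := by
      calc _ ≤ ((6 : ℝ≥0∞) ^ 3 * (∫⁻ y, f y ^ (3 / 2 : ℝ)) ^ 2) ^ (1 / 3 : ℝ) := by
            refine ENNReal.rpow_le_rpow ?_ (by norm_num)
            simp only [show (3 : ℝ) = ((3 : ℕ) : ℝ) by norm_num, ENNReal.rpow_natCast]
            refine (lintegral_arc_average_cube_le hf).trans ?_
            norm_num
            gcongr
            norm_num
        _ = 6 * Nf := by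
            rw [ENNReal.mul_rpow_of_nonneg _ _ (by norm_num), ← ENNReal.rpow_natCast,
              ← ENNReal.rpow_natCast, ← ENNReal.rpow_mul, ← ENNReal.rpow_mul]
            norm_num [Nf]
    calc _ ≤ Ng * (6 * Nf) := by
          refine mul_le_mul' (le_of_eq ?_) hcube
          norm_num [Ng]
      _ = 6 * (Nf * Ng) := by ring
  calc ∫⁻ x, ∫⁻ y, (arcStrip ρ).indicator 1 (x - y) * (f x * g y)
      = ∫⁻ y, ∫⁻ x, (arcStrip ρ).indicator 1 (x - y) * (f x * g y) :=
        lintegral_lintegral_swap (by fun_prop)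
    _ = ∫⁻ y, g y * ∫⁻ z, (arcStrip ρ).indicator 1 z * f (y + z) := by
        refine lintegral_congr fun y => ?_
        rw [← lintegral_add_right_eq_self _ y, ← lintegral_const_mul _ (by fun_prop)]
        refine lintegral_congr fun z => ?_
        rw [add_sub_cancel_right, add_comm z y]
        ring
    _ = ∫⁻ y, ∫⁻ s in Icc (-ρ) ρ, g y * ∫⁻ u in arcInterval, f (y + !₂[0, s] + arcPoint u) := by
        refine lintegral_congr fun y => ?_
        rw [lintegral_arcStrip ρ (f := fun z => f (y + z)) (by fun_prop), ← lintegral_const_mul]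
        · simp only [add_assoc]
        · exact Measurable.lintegral_prod_right' (f := fun q : ℝ × ℝ =>
            f (y + (!₂[0, q.1] + arcPoint q.2))) (by fun_prop)
    _ = ∫⁻ s in Icc (-ρ) ρ, ∫⁻ y, g y * ∫⁻ u in arcInterval, f (y + !₂[0, s] + arcPoint u) := by
        refine lintegral_lintegral_swap (Measurable.aemeasurable ?_)
        refine (hg.comp measurable_fst).mul ?_
        exact Measurable.lintegral_prod_right' (f := fun q : (EuclideanSpace ℝ (Fin 2) × ℝ) × ℝ =>
            f (q.1.1 + !₂[0, q.1.2] + arcPoint q.2)) (by fun_prop)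
    _ ≤ ∫⁻ _ in Icc (-ρ) ρ, 6 * (Nf * Ng) := lintegral_mono fun s => hslice _
    _ = ENNReal.ofReal (12 * ρ) * (Nf * Ng) := by
        rw [setLIntegral_const, Real.volume_Icc, mul_comm, ← mul_assoc,
          show (12 * ρ) = 6 * (ρ - -ρ) by ring, ENNReal.ofReal_mul (by norm_num)]
        rw [mul_comm (ENNReal.ofReal (ρ - -ρ))]
        norm_num

/-- Rotation of the plane by a right angle. -/
def quarterTurn : EuclideanSpace ℝ (Fin 2) ≃ₗᵢ[ℝ] EuclideanSpace ℝ (Fin 2) where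
  toFun z := !₂[-z 1, z 0]
  map_add' x y := by ext i; fin_cases i <;> simp [add_comm]
  map_smul' r x := by ext i; fin_cases i <;> simp
  invFun z := !₂[z 1, -z 0]
  left_inv x := by ext i; fin_cases i <;> simp
  right_inv x := by ext i; fin_cases i <;> simp
  norm_map' x := by simp [EuclideanSpace.norm_eq, Fin.sum_univ_two, add_comm]

@[simp] lemma quarterTurn_apply_zero (z : EuclideanSpace ℝ (Fin 2)) : quarterTurn z 0 = -z 1 := rfl

@[simp] lemma quarterTurn_apply_one (z : EuclideanSpace ℝ (Fin 2)) : quarterTurn z 1 = z 0 := rfl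

lemma norm_sq_plane (z : EuclideanSpace ℝ (Fin 2)) : ‖z‖ ^ 2 = z 0 ^ 2 + z 1 ^ 2 := by
  simp [EuclideanSpace.norm_sq_eq, Fin.sum_univ_two]

lemma mem_arcStrip_of_sector {ε : ℝ} (hε : 0 < ε) (hε' : ε ≤ 1 / 10)
    {z : EuclideanSpace ℝ (Fin 2)} (h1 : 1 - ε ≤ ‖z‖) (h2 : ‖z‖ ≤ 1 + ε) (hz : |z 0| ≤ z 1) :
    z ∈ arcStrip (4 * ε) := by
  have hn := norm_sq_plane z
  have hz1 : 0 ≤ z 1 := (abs_nonneg _).trans hz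
  have hsq : z 0 ^ 2 ≤ z 1 ^ 2 := by
    rw [← sq_abs (z 0)]
    gcongr
  have hup : ‖z‖ ^ 2 ≤ (1 + ε) ^ 2 := by gcongr
  have hlo : (1 - ε) ^ 2 ≤ ‖z‖ ^ 2 := by
    have : 0 ≤ 1 - ε := by linarith
    gcongr
  have h0 : z 0 ^ 2 ≤ 605 / 1000 := by nlinarith
  have hI : |z 0| ≤ 4 / 5 := abs_le_of_sq_le_sq (by linarith) (by norm_num)
  refine ⟨abs_le.1 hI, ?_⟩
  set φ := √(1 - z 0 ^ 2) with hφ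
  have hφ2 : φ ^ 2 = 1 - z 0 ^ 2 := Real.sq_sqrt (by linarith)
  have hφ0 : 3 / 5 ≤ φ := Real.le_sqrt_of_sq_le (by linarith)
  have hprod : (z 1 - φ) * (z 1 + φ) = ‖z‖ ^ 2 - 1 := by
    rw [hn]
    nlinarith
  rw [abs_le]
  constructor <;> nlinarith

lemma isPairBound_mollSigma_of_le {ε : ℝ} (hε : 0 < ε) (hε' : ε ≤ 1 / 10) :
    IsPairBound (mollSigma 2 ε) 720 := by
  have hS := isPairBound_arcStrip (4 * ε)
  have hm : Measurable ((arcStrip (4 * ε)).indicator (1 : EuclideanSpace ℝ (Fin 2) → ℝ≥0∞)) :=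
    measurable_one.indicator (measurableSet_arcStrip _)
  set K := (arcStrip (4 * ε)).indicator (1 : EuclideanSpace ℝ (Fin 2) → ℝ≥0∞)
  set J := quarterTurn
  have hJ := fun T : EuclideanSpace ℝ (Fin 2) ≃ₗᵢ[ℝ] EuclideanSpace ℝ (Fin 2) =>
    hS.comp_isometry hm T
  have hJm (T : EuclideanSpace ℝ (Fin 2) ≃ₗᵢ[ℝ] EuclideanSpace ℝ (Fin 2)) :
      Measurable fun z => K (T z) := hm.comp T.continuous.measurable
  have hsum := ((hS.add hm (hJ J)).add (hm.add (hJm J)) (hJ (J.trans J))).add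
    ((hm.add (hJm J)).add (hJm (J.trans J))) (hJ (J.trans (J.trans J)))
  refine (hsum.const_mul (r := ENNReal.ofReal (1 / (2 * ε))) ENNReal.ofReal_ne_top).mono ?_ ?_
  · intro z
    unfold mollSigma
    split_ifs with hz
    · refine le_mul_of_one_le_right' ?_
      have hK : ∀ T : EuclideanSpace ℝ (Fin 2) ≃ₗᵢ[ℝ] EuclideanSpace ℝ (Fin 2),
          |T z 0| ≤ T z 1 → K (T z) = 1 := fun T hT => indicator_of_mem
        (mem_arcStrip_of_sector hε hε' (by simpa using hz.1) (by simpa using hz.2) hT) _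
      have hcases : |z 0| ≤ z 1 ∨ |z 1| ≤ z 0 ∨ |z 0| ≤ -z 1 ∨ |z 1| ≤ -z 0 := by
        rcases le_total |z 0| |z 1| with c | c
        · rcases abs_choice (z 1) with b | b <;> simp only [b] at c <;> tauto
        · rcases abs_choice (z 0) with b | b <;> simp only [b] at c <;> tauto
      rcases hcases with h | h | h | h
      · have := hK (.refl ℝ _) h
        simp only [LinearIsometryEquiv.coe_refl, id] at this
        simp [this, add_assoc]
      · have := hK J (by simpa [J] using h)
        simp [this, add_assoc, add_left_comm (K z)]
      · have := hK (J.trans J) (by simpa [J] using h)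
        simp only [Pi.add_apply, this]
        exact (self_le_add_left _ _).trans (self_le_add_right _ _)
      · have := hK (J.trans (J.trans J)) (by simpa [J] using h)
        simp only [Pi.add_apply, this]
        exact self_le_add_left _ _
    · exact zero_le
  · rw [show ENNReal.ofReal (12 * (4 * ε)) + ENNReal.ofReal (12 * (4 * ε)) +
      ENNReal.ofReal (12 * (4 * ε)) + ENNReal.ofReal (12 * (4 * ε)) =
      4 * ENNReal.ofReal (12 * (4 * ε)) by ring,
      show (4 : ℝ≥0∞) = ENNReal.ofReal 4 by norm_num,
      show (720 : ℝ≥0∞) = ENNReal.ofReal 720 by norm_num,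
      ← ENNReal.ofReal_mul (by norm_num), ← ENNReal.ofReal_mul (by positivity)]
    refine ENNReal.ofReal_le_ofReal ?_
    field_simp
    norm_num

lemma isPairBound_mollSigma_of_ge {ε : ℝ} (hε : 1 / 10 ≤ ε) (hε' : ε < 1) :
    IsPairBound (mollSigma 2 ε) 720 := by
  have hS := isPairBound_arcStrip 4
  have hm : Measurable ((arcStrip 4).indicator (1 : EuclideanSpace ℝ (Fin 2) → ℝ≥0∞)) :=
    measurable_one.indicator (measurableSet_arcStrip _)
  set K := (arcStrip 4).indicator (1 : EuclideanSpace ℝ (Fin 2) → ℝ≥0∞)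
  have hKm (c : EuclideanSpace ℝ (Fin 2)) : Measurable fun z => K (z + c) :=
    hm.comp (measurable_add_const c)
  have hsum := ((hS.translate !₂[3 / 2, 0]).add (hKm _) (hS.translate 0)).add
    ((hKm _).add (hKm _)) (hS.translate !₂[-(3 / 2), 0])
  refine (hsum.const_mul (r := 5) (by norm_num)).mono ?_ ?_
  · intro z
    unfold mollSigma
    split_ifs with hz
    · have hn := norm_sq_plane z
      have h4 : ‖z‖ ^ 2 ≤ 2 ^ 2 := by
        have : ‖z‖ ≤ 2 := by linarith [hz.2]
        gcongr
      have h0 := abs_le.1 (abs_le_of_sq_le_sq (a := z 0) (b := 2) (by nlinarith) (by norm_num))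
      have h1 := abs_le.1 (abs_le_of_sq_le_sq (a := z 1) (b := 2) (by nlinarith) (by norm_num))
      have hK : ∀ c : ℝ, |z 0 + c| ≤ 4 / 5 → K (z + !₂[c, 0]) = 1 := by
        intro c hc
        have hI : (z + !₂[c, 0]) 0 ∈ arcInterval := by simpa [arcInterval, abs_le] using hc
        refine indicator_of_mem (s := arcStrip 4) ⟨hI, ?_⟩ _
        have a1 : √(1 - (z + !₂[c, 0]) 0 ^ 2) ≤ 1 :=
          Real.sqrt_le_one.2 (sub_le_self _ (sq_nonneg _))
        have a2 := Real.sqrt_nonneg (1 - (z + !₂[c, 0]) 0 ^ 2)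
        have a3 : (z + !₂[c, 0]) 1 = z 1 := by simp
        rw [a3, abs_le]
        constructor <;> linarith
      have h5 : ENNReal.ofReal (1 / (2 * ε)) ≤ 5 := by
        rw [show (5 : ℝ≥0∞) = ENNReal.ofReal 5 by norm_num]
        refine ENNReal.ofReal_le_ofReal ?_
        rw [div_le_iff₀ (by linarith)]
        linarith
      refine h5.trans (le_mul_of_one_le_right' ?_)
      have hcases : |z 0 + 3 / 2| ≤ 4 / 5 ∨ |z 0 + 0| ≤ 4 / 5 ∨ |z 0 + -(3 / 2)| ≤ 4 / 5 := by
        simp only [abs_le]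
        rcases le_total (z 0) (-(4 / 5)) with h | h
        · exact Or.inl ⟨by linarith, by linarith⟩
        rcases le_total (z 0) (4 / 5) with h' | h'
        · exact Or.inr (Or.inl ⟨by linarith, by linarith⟩)
        · exact Or.inr (Or.inr ⟨by linarith, by linarith⟩)
      rcases hcases with h | h | h
      · simp only [Pi.add_apply, hK _ h]
        exact (self_le_add_right _ _).trans (self_le_add_right _ _)
      · have := hK _ h
        rw [show (!₂[0, 0] : EuclideanSpace ℝ (Fin 2)) = 0 by ext i; fin_cases i <;> rfl] at this
        simp only [Pi.add_apply, this]
        exact (self_le_add_left _ _).trans (self_le_add_right _ _)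
      · simp only [Pi.add_apply, hK _ h]
        exact self_le_add_left _ _
    · exact zero_le
  · norm_num

/-- The mollified circle kernels are uniformly bounded on `L^{3/2} × L^{3/2}`. -/
lemma isPairBound_mollSigma {ε : ℝ} (hε : ε ∈ Ioo (0 : ℝ) 1) :
    IsPairBound (mollSigma 2 ε) 720 := by
  rcases le_total ε (1 / 10) with h | h
  · exact isPairBound_mollSigma_of_le hε.1 h
  · exact isPairBound_mollSigma_of_ge h hε.2

lemma measurable_mollSigma (d : ℕ) (ε : ℝ) : Measurable (mollSigma d ε) := by
  unfold mollSigma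
  refine Measurable.ite ?_ measurable_const measurable_const
  exact (measurableSet_le measurable_const measurable_norm).inter
    (measurableSet_le measurable_norm measurable_const)

lemma lintegral_mollSigma_le {ε : ℝ} (hε : ε ∈ Ioo (0 : ℝ) 1) :
    ∫⁻ z, mollSigma 2 ε z ≤ ENNReal.ofReal (2 * Real.pi) := by
  obtain ⟨h0, h1⟩ := hε
  have hset : {z : EuclideanSpace ℝ (Fin 2) | 1 - ε ≤ ‖z‖ ∧ ‖z‖ ≤ 1 + ε} =
      Metric.closedBall 0 (1 + ε) \ Metric.ball 0 (1 - ε) := by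
    ext z
    simp [and_comm]
  have hmol : mollSigma 2 ε = {z | 1 - ε ≤ ‖z‖ ∧ ‖z‖ ≤ 1 + ε}.indicator
      fun _ => ENNReal.ofReal (1 / (2 * ε)) := by
    ext z
    simp [mollSigma, indicator]
  rw [hmol, hset, lintegral_indicator_const (measurableSet_closedBall.diff measurableSet_ball),
    measure_sdiff (Metric.ball_subset_closedBall.trans' (Metric.ball_subset_ball (by linarith)))
      measurableSet_ball.nullMeasurableSet measure_ball_lt_top.ne,
    EuclideanSpace.volume_closedBall_fin_two, EuclideanSpace.volume_ball_fin_two]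
  rw [← ENNReal.ofReal_pow (by linarith),
    ← ENNReal.ofReal_pow (by linarith), ← ENNReal.ofReal_mul (by positivity),
    ← ENNReal.ofReal_mul (by positivity), ← ENNReal.ofReal_sub _ (by positivity),
    ← ENNReal.ofReal_mul (by positivity)]
  refine ENNReal.ofReal_le_ofReal (le_of_eq ?_)
  field_simp
  ring

section Submersion

variable {κ Y : Type*} [Fintype κ] [NormedAddCommGroup Y] [NormedSpace ℝ Y]
  [FiniteDimensional ℝ Y] [MeasurableSpace Y] [BorelSpace Y] (μ : Measure Y) [μ.IsAddHaarMeasure]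

/-- The part of a ball where a surjective linear map is `ε`-close to a given value has measure
`O(ε ^ r)`, where `r` is the rank. -/
lemma exists_measure_le_of_surjective {A : Y →ₗ[ℝ] κ → ℝ} (hA : Function.Surjective A) (M : ℝ)
    (t : κ → ℝ) :
    ∃ C : ℝ≥0∞, C ≠ ∞ ∧ ∀ ε : ℝ, 0 < ε → μ {y | ‖y‖ ≤ M ∧ ∀ q, |A y q - t q| ≤ ε} ≤
      C * ENNReal.ofReal ε ^ Fintype.card κ := by
  obtain ⟨R, hR⟩ := A.exists_rightInverse_of_surjective (LinearMap.range_eq_top.2 hA)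
  have hAR : ∀ s, A (R s) = s := fun s => LinearMap.congr_fun hR s
  let e : Y ≃ₗ[ℝ] LinearMap.ker A × (κ → ℝ) :=
    { toFun := fun y => (⟨y - R (A y), by simp [hAR]⟩, A y)
      map_add' := fun x y => by
        ext1
        · ext1
          simp only [map_add, Prod.fst_add, Submodule.coe_add]
          abel
        · simp
      map_smul' := fun r x => by
        ext1
        · ext1
          simp [smul_sub]
        · simp
      invFun := fun p => p.1 + R p.2
      left_inv := fun y => by simp
      right_inv := fun p => by
        have hp : A (p.1 : Y) = 0 := p.1.2
        ext1
        · ext1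
          simp [hAR, hp]
        · simp [hAR, hp] }
  let L := e.toContinuousLinearEquiv
  let ν : Measure (LinearMap.ker A) := Measure.addHaar
  have hmap : (μ.map L).IsAddHaarMeasure := L.isAddHaarMeasure_map μ
  have hν := Measure.isAddLeftInvariant_eq_smul (μ.map L) (ν.prod volume)
  set c := Measure.addHaarScalarFactor (μ.map L) (ν.prod volume)
  set N := ‖(L : Y →L[ℝ] LinearMap.ker A × (κ → ℝ))‖
  refine ⟨c * (ν (Metric.closedBall 0 (N * M)) * 2 ^ Fintype.card κ), ?_, fun ε hε => ?_⟩
  · have : ν (Metric.closedBall 0 (N * M)) ≠ ∞ := measure_closedBall_lt_top.ne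
    finiteness
  have hsub : {y | ‖y‖ ≤ M ∧ ∀ q, |A y q - t q| ≤ ε} ⊆
      L ⁻¹' (Metric.closedBall 0 (N * M) ×ˢ Metric.closedBall t ε) := by
    rintro y ⟨hy, hyε⟩
    refine ⟨?_, ?_⟩
    · rw [mem_closedBall_zero_iff]
      refine (norm_fst_le (L y)).trans ?_
      refine ((L : Y →L[ℝ] LinearMap.ker A × (κ → ℝ)).le_opNorm y).trans ?_
      gcongr
    · rw [Metric.mem_closedBall, dist_pi_le_iff hε.le]
      exact hyε
  calc μ {y | ‖y‖ ≤ M ∧ ∀ q, |A y q - t q| ≤ ε}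
      ≤ μ.map L (Metric.closedBall 0 (N * M) ×ˢ Metric.closedBall t ε) := by
        rw [Measure.map_apply L.continuous.measurable
          (measurableSet_closedBall.prod measurableSet_closedBall)]
        exact measure_mono hsub
    _ = c * (ν (Metric.closedBall 0 (N * M)) * ENNReal.ofReal ((2 * ε) ^ Fintype.card κ)) := by
        rw [hν, Measure.smul_apply, Measure.prod_prod, Real.volume_pi_closedBall _ hε.le]
        rfl
    _ = _ := by
        rw [ENNReal.ofReal_pow (by positivity), ENNReal.ofReal_mul (by norm_num), mul_pow,
          ENNReal.ofReal_ofNat]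
        ring

variable {X : Type*} [NormedAddCommGroup X] [NormedSpace ℝ X]

/-- If the derivative of `F` at `p`, restricted to the range of `ι`, is surjective, then the
slices along `ι` of the `ε`-neighbourhood of a fibre of `F` have, near `p`, measure `O(ε ^ r)`. -/
lemma exists_measure_slice_le [FiniteDimensional ℝ X] {F : X → κ → ℝ} {D : X →L[ℝ] κ → ℝ} {p : X}
    (hF : HasStrictFDerivAt F D p) {ι : Y →L[ℝ] X} (hι : ∀ z, ‖z‖ ≤ ‖ι z‖)
    (hsurj : Function.Surjective fun z => D (ι z)) (t : κ → ℝ) :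
    ∃ U ∈ nhds p, ∃ C : ℝ≥0∞, C ≠ ∞ ∧ ∀ ε ∈ Ioo (0 : ℝ) 1, ∀ w : X,
      μ {z | w + ι z ∈ U ∧ ∀ q, |F (w + ι z) q - t q| ≤ ε} ≤
        C * ENNReal.ofReal ε ^ Fintype.card κ := by
  let A : Y →L[ℝ] κ → ℝ := D.comp ι
  obtain ⟨R', hR'⟩ := A.toLinearMap.exists_rightInverse_of_surjective
    (LinearMap.range_eq_top.2 hsurj)
  let R : (κ → ℝ) →L[ℝ] Y := R'.toContinuousLinearMap
  have hAR : ∀ s, A (R s) = s := fun s => LinearMap.congr_fun hR' s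
  have hdet : (((1 / 2 : ℝ≥0)) : ℝ≥0∞) < ENNReal.ofReal |(ContinuousLinearMap.id ℝ Y).det| := by
    simp [ContinuousLinearMap.det]
  obtain ⟨δ, hδ, hδ0⟩ := ((mul_le_addHaar_image_of_lt_det μ _ hdet).and
    self_mem_nhdsWithin).exists
  have hδ0 : 0 < δ := hδ0
  set c : ℝ≥0 := δ / (‖R‖₊ * ‖ι‖₊ + 1)
  have hc : 0 < c := by positivity
  obtain ⟨U₁, hU₁, happ⟩ := hF.approximates_deriv_on_nhds (Or.inr hc)
  set M : ℝ := 2 * (1 + ‖R‖ * ‖A‖) + ‖R‖ * (‖t‖ + 1)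
  obtain ⟨C, hC, hCε⟩ := exists_measure_le_of_surjective μ (A := A.toLinearMap) hsurj M t
  refine ⟨U₁ ∩ Metric.ball p 1, Filter.inter_mem hU₁ (Metric.ball_mem_nhds p one_pos), 2 * C,
    by finiteness, fun ε hε w => ?_⟩
  set S := {z | w + ι z ∈ U₁ ∩ Metric.ball p 1 ∧ ∀ q, |F (w + ι z) q - t q| ≤ ε} with hS
  rcases S.eq_empty_or_nonempty with h | ⟨z₀, hz₀⟩
  · simp [h]
  let Φ : Y → Y := fun z => z - z₀ + R (F (w + ι z) - A (z - z₀))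
  have hΦ : ApproximatesLinearOn Φ (ContinuousLinearMap.id ℝ Y) S δ := by
    intro x hx y hy
    have h1 := happ _ hx.1.1 _ hy.1.1
    have h2 : Φ x - Φ y - (ContinuousLinearMap.id ℝ Y) (x - y) =
        R (F (w + ι x) - F (w + ι y) - D ((w + ι x) - (w + ι y))) := by
      simp only [Φ, A, map_sub, ContinuousLinearMap.comp_apply, ContinuousLinearMap.id_apply,
        map_add]
      abel
    rw [h2]
    calc _ ≤ ‖R‖ * (c * ‖(w + ι x) - (w + ι y)‖) := (R.le_opNorm _).trans (by gcongr)
      _ ≤ ‖R‖ * (c * (‖ι‖ * ‖x - y‖)) := by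
        rw [add_sub_add_left_eq_sub, ← map_sub]
        gcongr
        exact ι.le_opNorm _
      _ = (c * (‖R‖ * ‖ι‖)) * ‖x - y‖ := by ring
      _ ≤ δ * ‖x - y‖ := by
        gcongr
        have : c * (‖R‖₊ * ‖ι‖₊) ≤ δ := by
          calc c * (‖R‖₊ * ‖ι‖₊) ≤ c * (‖R‖₊ * ‖ι‖₊ + 1) := by gcongr; exact le_self_add
            _ = δ := div_mul_cancel₀ _ (by positivity)
        exact_mod_cast this
  have himg : Φ '' S ⊆ {y | ‖y‖ ≤ M ∧ ∀ q, |A.toLinearMap y q - t q| ≤ ε} := by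
    rintro _ ⟨z, hz, rfl⟩
    have hAΦ : A (Φ z) = F (w + ι z) := by
      simp only [Φ, map_add, hAR, map_sub]
      abel
    refine ⟨?_, fun q => ?_⟩
    · have h1 : ‖z - z₀‖ ≤ 2 := by
        refine (hι _).trans ?_
        have h2 := mem_ball_iff_norm.1 hz.1.2
        have h3 := mem_ball_iff_norm.1 hz₀.1.2
        calc ‖ι (z - z₀)‖ = ‖(w + ι z - p) - (w + ι z₀ - p)‖ := by
              rw [map_sub]
              congr 1
              abel
          _ ≤ 2 := (norm_sub_le _ _).trans (by linarith)
      have h4 : ‖F (w + ι z)‖ ≤ ‖t‖ + 1 := by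
        refine norm_le_norm_add_const_of_dist_le ((dist_pi_le_iff zero_le_one).2 fun q => ?_)
        exact (hz.2 q).trans hε.2.le
      calc ‖Φ z‖ ≤ ‖z - z₀‖ + ‖R‖ * (‖F (w + ι z)‖ + ‖A‖ * ‖z - z₀‖) := by
            refine (norm_add_le _ _).trans ?_
            gcongr
            refine (R.le_opNorm _).trans ?_
            gcongr
            refine (norm_sub_le _ _).trans ?_
            gcongr
            exact A.le_opNorm _
        _ ≤ 2 + ‖R‖ * ((‖t‖ + 1) + ‖A‖ * 2) := by gcongr
        _ = M := by simp only [M]; ring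
    · have : A.toLinearMap (Φ z) = F (w + ι z) := hAΦ
      rw [this]
      exact hz.2 q
  have hhalf := hδ S Φ hΦ
  calc μ S = 2 * (((1 / 2 : ℝ≥0) : ℝ≥0∞) * μ S) := by
        rw [← mul_assoc, show ((1 / 2 : ℝ≥0) : ℝ≥0∞) = 2⁻¹ by simp,
          ENNReal.mul_inv_cancel (by norm_num) (by norm_num), one_mul]
    _ ≤ 2 * (C * ENNReal.ofReal ε ^ Fintype.card κ) := by
        exact mul_le_mul_right (hhalf.trans ((measure_mono himg).trans (hCε ε hε.1))) 2
    _ = _ := by ring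

end Submersion

section Graph

variable {n : ℕ} {G : SimpleGraph (Fin n)} [Fintype G.edgeSet]

lemma distMap_mk (x : Fin n → EuclideanSpace ℝ (Fin 2)) {k l : Fin n} (h : s(k, l) ∈ G.edgeSet) :
    distMap G x ⟨s(k, l), h⟩ = ‖x k - x l‖ :=
  dist_eq_norm (x k) (x l)

lemma distMap_sub_const (x : Fin n → EuclideanSpace ℝ (Fin 2)) (c : EuclideanSpace ℝ (Fin 2)) :
    distMap G (fun k => x k - c) = distMap G x := by
  funext ⟨e, he⟩
  induction e using Sym2.ind with
  | _ k l => simp [distMap_mk]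

lemma contDiffAt_distMap {p : Fin n → EuclideanSpace ℝ (Fin 2)} (hp : distMap G p = fun _ => 1) :
    ContDiffAt ℝ 1 (distMap G) p := by
  refine contDiffAt_pi.2 fun ⟨e, he⟩ => ?_
  induction e using Sym2.ind with
  | _ k l =>
    have h1 := congr_fun hp ⟨s(k, l), he⟩
    rw [distMap_mk] at h1
    have hne : p k ≠ p l := by
      intro h
      simp [h] at h1
    exact ContDiffAt.dist ℝ (f := fun x : Fin n → EuclideanSpace ℝ (Fin 2) => x k)
      (g := fun x => x l) (by fun_prop) (by fun_prop) hne

lemma continuous_distMap : Continuous (distMap G) := by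
  refine continuous_pi fun ⟨e, he⟩ => ?_
  induction e using Sym2.ind with
  | _ k l =>
    change Continuous fun x : Fin n → EuclideanSpace ℝ (Fin 2) => dist (x k) (x l)
    fun_prop

lemma fderiv_distMap_mk {p : Fin n → EuclideanSpace ℝ (Fin 2)} (hp : distMap G p = fun _ => 1)
    (v : Fin n → EuclideanSpace ℝ (Fin 2)) {k l : Fin n} (h : s(k, l) ∈ G.edgeSet) :
    fderiv ℝ (distMap G) p v ⟨s(k, l), h⟩ = inner ℝ (p k - p l) (v k - v l) := by
  have h1 := (contDiffAt_distMap hp).differentiableAt one_ne_zero |>.hasFDerivAt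
  have h2 := (hasFDerivAt_pi'.1 h1 ⟨s(k, l), h⟩).pow 2
  let T : (Fin n → EuclideanSpace ℝ (Fin 2)) →L[ℝ] EuclideanSpace ℝ (Fin 2) :=
    ContinuousLinearMap.proj (R := ℝ) (φ := fun _ => EuclideanSpace ℝ (Fin 2)) k -
      ContinuousLinearMap.proj (R := ℝ) (φ := fun _ => EuclideanSpace ℝ (Fin 2)) l
  have hfun : (fun x => distMap G x ⟨s(k, l), h⟩ ^ 2) = fun x => ‖T x‖ ^ 2 :=
    funext fun x => by rw [distMap_mk]; rfl
  rw [hfun] at h2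
  have h3 := congrArg (fun S => S v) (h2.unique (T.hasFDerivAt (x := p)).norm_sq)
  have h4 := congr_fun hp ⟨s(k, l), h⟩
  simpa [h4, T, inner_sub_left, inner_sub_right] using h3

/-- Extension of a partial configuration by zero. -/
def extendZero (s : Finset (Fin n)) :
    (s → EuclideanSpace ℝ (Fin 2)) →L[ℝ] (Fin n → EuclideanSpace ℝ (Fin 2)) :=
  LinearMap.toContinuousLinearMap
    { toFun := fun z k => if h : k ∈ s then z ⟨k, h⟩ else 0
      map_add' := fun x y => by
        ext1 k
        by_cases h : k ∈ s <;> simp [h]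
      map_smul' := fun r x => by
        ext1 k
        by_cases h : k ∈ s <;> simp [h] }

lemma extendZero_apply (s : Finset (Fin n)) (z : s → EuclideanSpace ℝ (Fin 2)) (k : Fin n) :
    extendZero s z k = if h : k ∈ s then z ⟨k, h⟩ else 0 := rfl

lemma norm_le_norm_extendZero (s : Finset (Fin n)) (z : s → EuclideanSpace ℝ (Fin 2)) :
    ‖z‖ ≤ ‖extendZero s z‖ := by
  refine (pi_norm_le_iff_of_nonneg (norm_nonneg _)).2 fun k => ?_
  have := norm_le_pi_norm (extendZero s z) k
  simpa [extendZero_apply] using this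

lemma updateFinset_eq_add_extendZero (x : Fin n → EuclideanSpace ℝ (Fin 2)) (s : Finset (Fin n))
    (z : s → EuclideanSpace ℝ (Fin 2)) :
    Function.updateFinset x s z = Function.updateFinset x s 0 + extendZero s z := by
  ext1 k
  by_cases h : k ∈ s <;> simp [Function.updateFinset, extendZero_apply, h]

lemma eq_smul_quarterTurn {u w : EuclideanSpace ℝ (Fin 2)} (hu : ‖u‖ = 1)
    (huw : inner ℝ u w = 0) : w = (inner ℝ (quarterTurn u) w : ℝ) • quarterTurn u := by
  have h1 := norm_sq_plane u
  rw [hu] at h1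
  simp only [PiLp.inner_apply, RCLike.inner_apply, conj_trivial, Fin.sum_univ_two] at huw
  ext i
  fin_cases i
  · simp [PiLp.inner_apply, Fin.sum_univ_two]
    linear_combination w 0 * h1 + u 0 * huw
  · simp [PiLp.inner_apply, Fin.sum_univ_two]
    linear_combination w 1 * h1 + u 1 * huw

lemma inner_quarterTurn_self (u : EuclideanSpace ℝ (Fin 2)) : inner ℝ u (quarterTurn u) = 0 := by
  simp [PiLp.inner_apply, Fin.sum_univ_two]
  ring

/-- At a regular unit-distance realization, the edge lengths other than that of `{i, j}` have
surjective derivative already in the directions fixing the vertices `i` and `j`. -/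
lemma surjective_fderiv_distMap_extendZero {p : Fin n → EuclideanSpace ℝ (Fin 2)}
    (hp : distMap G p = fun _ => 1) (hsurj : Function.Surjective (fderiv ℝ (distMap G) p))
    {i j : Fin n} (hij : s(i, j) ∈ G.edgeSet) {s : Finset (Fin n)}
    (hs : ∀ k, k ∉ s → k = i ∨ k = j) :
    Function.Surjective fun z : s → EuclideanSpace ℝ (Fin 2) =>
      fun e : {e : G.edgeSet // e ≠ ⟨s(i, j), hij⟩} =>
        fderiv ℝ (distMap G) p (extendZero s z) e := by
  intro t
  obtain ⟨v, hv⟩ := hsurj fun e => if h : e ≠ ⟨s(i, j), hij⟩ then t ⟨e, h⟩ else 0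
  have hnorm : ‖p j - p i‖ = 1 := by
    have := congr_fun hp ⟨s(i, j), hij⟩
    rwa [distMap_mk, norm_sub_rev] at this
  have hperp : inner ℝ (p j - p i) (v j - v i) = 0 := by
    have := congr_fun hv ⟨s(i, j), hij⟩
    rw [fderiv_distMap_mk hp] at this
    rw [← neg_sub (p i), ← neg_sub (v i), inner_neg_neg]
    simpa using this
  have hrot := eq_smul_quarterTurn hnorm hperp
  set ω : ℝ := inner ℝ (quarterTurn (p j - p i)) (v j - v i)
  let v' : Fin n → EuclideanSpace ℝ (Fin 2) :=
    fun k => v k - v i - ω • quarterTurn (p k - p i)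
  refine ⟨fun k => v' k, ?_⟩
  have hv' : extendZero s (fun k => v' k) = v' := by
    ext1 k
    rw [extendZero_apply]
    split_ifs with hk
    · rfl
    · rcases hs k hk with rfl | rfl
      · simp [v']
      · simp only [v', ← hrot, sub_self]
  funext ⟨e, he⟩
  simp only [hv']
  have hve := congr_fun hv e
  rw [dif_pos he] at hve
  rw [← hve]
  obtain ⟨e, hmem⟩ := e
  induction e using Sym2.ind with
  | _ k l =>
    rw [fderiv_distMap_mk hp, fderiv_distMap_mk hp]
    have : v' k - v' l = (v k - v l) - ω • quarterTurn (p k - p l) := by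
      simp only [v', map_sub, smul_sub]
      abel
    rw [this, inner_sub_right, inner_smul_right, inner_quarterTurn_self, mul_zero, sub_zero]

lemma isCompact_setOf_distMap_le (hconn : G.Connected) (i : Fin n) :
    IsCompact {x : Fin n → EuclideanSpace ℝ (Fin 2) | x i = 0 ∧ ∀ e, |distMap G x e - 1| ≤ 1} := by
  have hwalk : ∀ k, ∃ r : ℝ, ∀ x : Fin n → EuclideanSpace ℝ (Fin 2), x i = 0 →
      (∀ e, |distMap G x e - 1| ≤ 1) → ‖x k‖ ≤ r := by
    intro k
    obtain ⟨w⟩ := hconn.preconnected k i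
    refine ⟨2 * w.length, fun x hxi hx => ?_⟩
    have : ∀ {a b : Fin n} (w : G.Walk a b), ‖x a - x b‖ ≤ 2 * w.length := by
      intro a b w
      induction w with
      | nil => simp
      | @cons a b c h w ih =>
        have he := hx ⟨s(a, b), G.mem_edgeSet.2 h⟩
        rw [distMap_mk] at he
        have := (abs_le.1 he).2
        have h3 := norm_add_le (x a - x b) (x b - x c)
        rw [sub_add_sub_cancel] at h3
        rw [SimpleGraph.Walk.length_cons]
        push_cast
        linarith
    simpa [hxi] using this w
  choose r hr using hwalk
  refine (isCompact_univ_pi fun k => isCompact_closedBall (0 : EuclideanSpace ℝ (Fin 2))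
    (r k)).of_isClosed_subset ?_ fun x hx k _ => by simpa using hr k x hx.1 hx.2
  have hF := continuous_distMap (G := G)
  have hset : {x : Fin n → EuclideanSpace ℝ (Fin 2) | x i = 0 ∧ ∀ e, |distMap G x e - 1| ≤ 1} =
      {x | x i = 0} ∩ ⋂ e, {x | |distMap G x e - 1| ≤ 1} := by
    ext
    simp
  rw [hset]
  exact (isClosed_eq (by fun_prop) continuous_const).inter
    (isClosed_iInter fun e => isClosed_le (by fun_prop) continuous_const)

/-- Uniform volume bound for the partial configurations that complete two adjacent vertices to an
approximate unit-distance realization. -/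
lemma exists_volume_fiber_le (hconn : G.Connected) (hreg : RegularlyRealizable G) {i j : Fin n}
    (hij : s(i, j) ∈ G.edgeSet) {s : Finset (Fin n)} (hs : ∀ k, k ∉ s → k = i ∨ k = j)
    (hi : i ∉ s) :
    ∃ C : ℝ≥0∞, C ≠ ∞ ∧ ∀ ε ∈ Ioo (0 : ℝ) 1, ∀ x : Fin n → EuclideanSpace ℝ (Fin 2),
      volume {z : s → EuclideanSpace ℝ (Fin 2) |
          ∀ e, |distMap G (Function.updateFinset x s z) e - 1| ≤ ε} ≤
        C * ENNReal.ofReal ε ^ Fintype.card {e : G.edgeSet // e ≠ ⟨s(i, j), hij⟩} := by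
  set m := Fintype.card {e : G.edgeSet // e ≠ ⟨s(i, j), hij⟩}
  let S : Set (Fin n → EuclideanSpace ℝ (Fin 2)) → ℝ → (Fin n → EuclideanSpace ℝ (Fin 2)) →
      Set (s → EuclideanSpace ℝ (Fin 2)) := fun U ε w =>
    {z | w + extendZero s z ∈ U ∧ ∀ e, |distMap G (w + extendZero s z) e - 1| ≤ ε}
  have hcover : ∃ C : ℝ≥0∞, C ≠ ∞ ∧ ∀ ε ∈ Ioo (0 : ℝ) 1,
      ∀ w, volume (S {x | x i = 0 ∧ ∀ e, |distMap G x e - 1| ≤ 1} ε w) ≤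
        C * ENNReal.ofReal ε ^ m := by
    refine (isCompact_setOf_distMap_le hconn i).induction_on
      (p := fun U => ∃ C : ℝ≥0∞, C ≠ ∞ ∧ ∀ ε ∈ Ioo (0 : ℝ) 1, ∀ w,
        volume (S U ε w) ≤ C * ENNReal.ofReal ε ^ m) ?_ ?_ ?_ ?_
    · exact ⟨0, by simp, fun ε _ w => by simp [S]⟩
    · rintro U U' hU ⟨C, hC, h⟩
      exact ⟨C, hC, fun ε hε w =>
        (measure_mono (show S U ε w ⊆ S U' ε w from fun z hz => ⟨hU hz.1, hz.2⟩)).trans (h ε hε w)⟩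
    · rintro U U' ⟨C, hC, h⟩ ⟨C', hC', h'⟩
      refine ⟨C + C', by finiteness, fun ε hε w => ?_⟩
      rw [add_mul]
      refine le_trans ?_ (add_le_add (h ε hε w) (h' ε hε w))
      refine (measure_mono ?_).trans (measure_union_le _ _)
      rintro z ⟨hz | hz, hzε⟩
      · exact Or.inl ⟨hz, hzε⟩
      · exact Or.inr ⟨hz, hzε⟩
    · intro p _
      suffices ∃ U ∈ nhds p, ∃ C : ℝ≥0∞, C ≠ ∞ ∧ ∀ ε ∈ Ioo (0 : ℝ) 1, ∀ w,
          volume (S U ε w) ≤ C * ENNReal.ofReal ε ^ m by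
        obtain ⟨U, hU, h⟩ := this
        exact ⟨U, mem_nhdsWithin_of_mem_nhds hU, h⟩
      by_cases hp : distMap G p = fun _ => 1
      · have hstrict := (contDiffAt_distMap hp).hasStrictFDerivAt one_ne_zero
        have hstrict' : HasStrictFDerivAt
            (fun x (e : {e : G.edgeSet // e ≠ ⟨s(i, j), hij⟩}) => distMap G x e)
            (ContinuousLinearMap.pi fun e : {e : G.edgeSet // e ≠ ⟨s(i, j), hij⟩} =>
              (ContinuousLinearMap.proj (e : G.edgeSet)).comp (fderiv ℝ (distMap G) p)) p :=
          hasStrictFDerivAt_pi.2 fun e => hasStrictFDerivAt_pi'.1 hstrict e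
        obtain ⟨U, hU, C, hC, h⟩ := exists_measure_slice_le volume hstrict'
          (norm_le_norm_extendZero s)
          (surjective_fderiv_distMap_extendZero hp (hreg.2 p hp).2 hij hs) (fun _ => 1)
        exact ⟨U, hU, C, hC, fun ε hε w =>
          (measure_mono fun z hz => by exact ⟨hz.1, fun e => hz.2 e⟩).trans (h ε hε w)⟩
      · obtain ⟨e, he⟩ := Function.ne_iff.1 hp
        have hpos : 0 < |distMap G p e - 1| := abs_pos.2 (sub_ne_zero.2 he)
        set δ := |distMap G p e - 1| / 2
        have hδ : 0 < δ := by positivity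
        have hF := continuous_distMap (G := G)
        refine ⟨{x | δ < |distMap G x e - 1|} ∩ Metric.ball p 1, Filter.inter_mem
          ((isOpen_lt continuous_const (by fun_prop)).mem_nhds (half_lt_self hpos))
          (Metric.ball_mem_nhds p one_pos),
          volume (Metric.closedBall (0 : s → EuclideanSpace ℝ (Fin 2)) 2) *
            (ENNReal.ofReal δ ^ m)⁻¹, ?_, fun ε hε w => ?_⟩
        · have h1 : volume (Metric.closedBall (0 : s → EuclideanSpace ℝ (Fin 2)) 2) ≠ ∞ :=
            measure_closedBall_lt_top.ne
          have h2 : ENNReal.ofReal δ ^ m ≠ 0 := pow_ne_zero _ (by simpa using hδ)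
          finiteness
        rcases (S ({x | δ < |distMap G x e - 1|} ∩ Metric.ball p 1) ε w).eq_empty_or_nonempty
          with h | ⟨z₀, hz₀⟩
        · simp [h]
        have hδε : δ ≤ ε := (lt_of_lt_of_le hz₀.1.1 (hz₀.2 e)).le
        calc volume (S _ ε w) ≤ volume (Metric.closedBall z₀ 2) := by
              refine measure_mono fun z hz => ?_
              rw [mem_closedBall_iff_norm]
              refine (norm_le_norm_extendZero s _).trans ?_
              have h2 := mem_ball_iff_norm.1 hz.1.2
              have h3 := mem_ball_iff_norm.1 hz₀.1.2
              calc ‖extendZero s (z - z₀)‖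
                  = ‖(w + extendZero s z - p) - (w + extendZero s z₀ - p)‖ := by
                    rw [map_sub]
                    congr 1
                    abel
                _ ≤ 2 := (norm_sub_le _ _).trans (by linarith)
          _ = volume (Metric.closedBall (0 : s → EuclideanSpace ℝ (Fin 2)) 2) *
                ((ENNReal.ofReal δ ^ m)⁻¹ * ENNReal.ofReal δ ^ m) := by
              rw [ENNReal.inv_mul_cancel (pow_ne_zero _ (by simpa using hδ)) (by finiteness),
                mul_one]
              exact Measure.addHaar_closedBall_center _ _ _
          _ ≤ _ := by
              rw [← mul_assoc]
              gcongr
  obtain ⟨C, hC, h⟩ := hcover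
  refine ⟨C, hC, fun ε hε x => ?_⟩
  refine le_trans ?_ (h ε hε (Function.updateFinset (fun k => x k - x i) s 0))
  rw [← measure_preimage_add_right volume (fun _ => -x i) (S _ ε _)]
  refine measure_mono fun z hz => ?_
  have hshift : Function.updateFinset (fun k => x k - x i) s 0 +
      extendZero s (z + fun _ => -x i) = fun k => Function.updateFinset x s z k - x i := by
    rw [← updateFinset_eq_add_extendZero]
    ext1 k
    by_cases hk : k ∈ s <;> simp [Function.updateFinset, hk, sub_eq_add_neg]
  have hz' : ∀ e, |distMap G (fun k => Function.updateFinset x s z k - x i) e - 1| ≤ ε := by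
    rw [distMap_sub_const]
    exact hz
  change _ ∧ _
  rw [hshift]
  refine ⟨⟨?_, fun e => (hz' e).trans hε.2.le⟩, hz'⟩
  simp [Function.updateFinset, hi]

end Graph

section Kernel

variable {n : ℕ} {G : SimpleGraph (Fin n)}

open Classical in
/-- The product of the mollified circle kernels over the edges of `G`. -/
def graphKernel (G : SimpleGraph (Fin n)) (ε : ℝ) (x : Fin n → EuclideanSpace ℝ (Fin 2)) : ℝ≥0∞ :=
  ∏ i, ∏ j, if i < j ∧ G.Adj i j then mollSigma 2 ε (x i - x j) else 1

lemma measurable_graphKernel (ε : ℝ) : Measurable (graphKernel G ε) := by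
  refine Finset.measurable_fun_prod _ fun i _ => Finset.measurable_fun_prod _ fun j _ => ?_
  split_ifs
  · exact (measurable_mollSigma 2 ε).comp (by fun_prop)
  · exact measurable_const

lemma mollSigma_eq_ite_abs (d : ℕ) (ε : ℝ) (y : EuclideanSpace ℝ (Fin d)) :
    mollSigma d ε y = if |‖y‖ - 1| ≤ ε then ENNReal.ofReal (1 / (2 * ε)) else 0 := by
  unfold mollSigma
  congr 1
  rw [abs_le, eq_iff_iff]
  constructor <;> rintro ⟨h1, h2⟩ <;> constructor <;> linarith

lemma graphKernel_eq_prod [Fintype G.edgeSet] (ε : ℝ) (x : Fin n → EuclideanSpace ℝ (Fin 2)) :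
    graphKernel G ε x =
      ∏ e : G.edgeSet, if |distMap G x e - 1| ≤ ε then ENNReal.ofReal (1 / (2 * ε)) else 0 := by
  classical
  unfold graphKernel
  rw [← Finset.prod_product', ← Finset.prod_filter]
  refine Finset.prod_bij (fun p hp => ⟨s(p.1, p.2), G.mem_edgeSet.2 (Finset.mem_filter.1 hp).2.2⟩)
    (fun _ _ => Finset.mem_univ _) ?_ ?_ ?_
  · rintro ⟨a, b⟩ hp ⟨c, d⟩ hq h
    have h1 := (Finset.mem_filter.1 hp).2.1
    have h2 := (Finset.mem_filter.1 hq).2.1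
    rcases Sym2.eq_iff.1 (Subtype.ext_iff.1 h) with ⟨h, h'⟩ | ⟨h, h'⟩
    · exact Prod.ext h h'
    · dsimp only at h h' h1 h2
      subst h h'
      exact absurd h1 h2.asymm
  · rintro ⟨e, he⟩ -
    induction e with | h a b =>
    have hab := G.mem_edgeSet.1 he
    rcases hab.ne.lt_or_gt with h | h
    · exact ⟨(a, b), by simp [h, hab], rfl⟩
    · exact ⟨(b, a), by simp [h, hab.symm], Subtype.ext Sym2.eq_swap⟩
  · rintro ⟨a, b⟩ hp
    rw [mollSigma_eq_ite_abs, distMap_mk]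

lemma graphKernel_le [Fintype G.edgeSet] {i j : Fin n} (hij : s(i, j) ∈ G.edgeSet) (ε : ℝ)
    (x : Fin n → EuclideanSpace ℝ (Fin 2)) :
    graphKernel G ε x ≤ mollSigma 2 ε (x i - x j) *
      ENNReal.ofReal (1 / (2 * ε)) ^ Fintype.card {e : G.edgeSet // e ≠ ⟨s(i, j), hij⟩} *
      {x | ∀ e, |distMap G x e - 1| ≤ ε}.indicator 1 x := by
  classical
  rw [graphKernel_eq_prod]
  by_cases hx : ∀ e, |distMap G x e - 1| ≤ ε
  · rw [Fintype.prod_eq_mul_prod_subtype_ne _ (⟨s(i, j), hij⟩ : G.edgeSet),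
      indicator_of_mem (by exact hx), distMap_mk, ← mollSigma_eq_ite_abs]
    simp [hx]
  · obtain ⟨e, he⟩ := not_forall.1 hx
    rw [Finset.prod_eq_zero (Finset.mem_univ e) (if_neg he)]
    exact zero_le

lemma lintegral_graphKernel_updateFinset_le [Fintype G.edgeSet] {i j : Fin n}
    (hij : s(i, j) ∈ G.edgeSet) {s : Finset (Fin n)} (hi : i ∉ s) (hj : j ∉ s) {C : ℝ≥0∞} {ε : ℝ}
    (hε : ε ∈ Ioo (0 : ℝ) 1) (x : Fin n → EuclideanSpace ℝ (Fin 2))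
    (hvol : volume {z : s → EuclideanSpace ℝ (Fin 2) |
        ∀ e, |distMap G (Function.updateFinset x s z) e - 1| ≤ ε} ≤
      C * ENNReal.ofReal ε ^ Fintype.card {e : G.edgeSet // e ≠ ⟨s(i, j), hij⟩}) :
    ∫⁻ z : s → EuclideanSpace ℝ (Fin 2), graphKernel G ε (Function.updateFinset x s z) ≤
      C * mollSigma 2 ε (x i - x j) := by
  set m := Fintype.card {e : G.edgeSet // e ≠ ⟨s(i, j), hij⟩}
  have hε2 : ENNReal.ofReal (1 / (2 * ε)) * ENNReal.ofReal ε ≤ 1 := by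
    rw [← ENNReal.ofReal_mul (by have := hε.1; positivity)]
    refine ENNReal.ofReal_le_one.2 ?_
    have := hε.1.ne'
    field_simp
    norm_num
  have hxi : ∀ z, Function.updateFinset x s z i = x i := fun z => by
    simp [Function.updateFinset, hi]
  have hxj : ∀ z, Function.updateFinset x s z j = x j := fun z => by
    simp [Function.updateFinset, hj]
  set S := {z : s → EuclideanSpace ℝ (Fin 2) |
    ∀ e, |distMap G (Function.updateFinset x s z) e - 1| ≤ ε}
  have hF := continuous_distMap (G := G)
  have hS : MeasurableSet S := by
    have hup : Measurable (Function.updateFinset x s) := measurable_updateFinset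
    have hFm := hF.measurable
    have : S = ⋂ e, {z | |distMap G (Function.updateFinset x s z) e - 1| ≤ ε} := by
      ext
      simp [S]
    rw [this]
    refine MeasurableSet.iInter fun e => measurableSet_le ?_ measurable_const
    have : Measurable fun z => distMap G (Function.updateFinset x s z) e :=
      (measurable_pi_apply e).comp (hFm.comp hup)
    fun_prop
  calc ∫⁻ z : s → EuclideanSpace ℝ (Fin 2), graphKernel G ε (Function.updateFinset x s z)
      ≤ ∫⁻ z : s → EuclideanSpace ℝ (Fin 2), (mollSigma 2 ε (x i - x j) *
          ENNReal.ofReal (1 / (2 * ε)) ^ m) * S.indicator 1 z := by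
        refine lintegral_mono fun z => ?_
        have := graphKernel_le hij ε (Function.updateFinset x s z)
        rwa [hxi, hxj] at this
    _ = mollSigma 2 ε (x i - x j) * ENNReal.ofReal (1 / (2 * ε)) ^ m *
          volume S := by
        rw [lintegral_const_mul _ (measurable_one.indicator hS), lintegral_indicator_one hS]
    _ ≤ mollSigma 2 ε (x i - x j) * ENNReal.ofReal (1 / (2 * ε)) ^ m *
          (C * ENNReal.ofReal ε ^ m) := by
        gcongr
    _ = C * mollSigma 2 ε (x i - x j) *
          (ENNReal.ofReal (1 / (2 * ε)) * ENNReal.ofReal ε) ^ m := by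
        rw [mul_pow]
        ring
    _ ≤ C * mollSigma 2 ε (x i - x j) * 1 := by
        gcongr
        exact pow_le_one₀ zero_le hε2
    _ = _ := mul_one _

lemma lmarginal_insert_singleton {i j : Fin n} (hij : i ≠ j)
    {h : EuclideanSpace ℝ (Fin 2) → EuclideanSpace ℝ (Fin 2) → ℝ≥0∞}
    (hh : Measurable (Function.uncurry h)) (x : Fin n → EuclideanSpace ℝ (Fin 2)) :
    (∫⋯∫⁻_insert i {j}, (fun x => h (x i) (x j)) ∂(fun _ => volume)) x = ∫⁻ a, ∫⁻ b, h a b := by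
  have hpair : Measurable fun x : Fin n → EuclideanSpace ℝ (Fin 2) => h (x i) (x j) :=
    Measurable.comp (g := Function.uncurry h) (f := fun x : Fin n → _ => (x i, x j)) hh
      (by fun_prop)
  rw [lmarginal_insert _ hpair (by simpa using hij)]
  simp [lmarginal_singleton, hij]

lemma lintegral_lintegral_const_mul
    {h : EuclideanSpace ℝ (Fin 2) → EuclideanSpace ℝ (Fin 2) → ℝ≥0∞}
    (hh : Measurable (Function.uncurry h)) (C : ℝ≥0∞) :
    ∫⁻ a, ∫⁻ b, C * h a b = C * ∫⁻ a, ∫⁻ b, h a b := by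
  rw [← lintegral_const_mul C (f := fun a => ∫⁻ b, h a b) hh.lintegral_prod_right']
  exact lintegral_congr fun a => lintegral_const_mul C hh.of_uncurry_left

/-- Integrating out all vertices other than those of a fixed edge leaves only the kernel of that
edge, up to a constant. -/
lemma exists_lintegral_graphKernel_mul_le [Fintype G.edgeSet] (hconn : G.Connected)
    (hreg : RegularlyRealizable G) {i j : Fin n} (hij : G.Adj i j) :
    ∃ C : ℝ≥0∞, C ≠ ∞ ∧ ∀ ε ∈ Ioo (0 : ℝ) 1,
      ∀ h : EuclideanSpace ℝ (Fin 2) → EuclideanSpace ℝ (Fin 2) → ℝ≥0∞,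
        Measurable (Function.uncurry h) →
        ∫⁻ x, graphKernel G ε x * h (x i) (x j) ≤
          C * ∫⁻ a, ∫⁻ b, mollSigma 2 ε (a - b) * h a b := by
  classical
  have hmem := G.mem_edgeSet.2 hij
  obtain ⟨s, hsdef⟩ : ∃ s : Finset (Fin n), s = Finset.univ \ {i, j} := ⟨_, rfl⟩
  have hi : i ∉ s := by simp [hsdef]
  have hj : j ∉ s := by simp [hsdef]
  obtain ⟨C, hC, hvol⟩ := exists_volume_fiber_le hconn hreg hmem (s := s)
    (fun k hk => by simpa [hsdef, or_iff_not_imp_left] using hk) hi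
  refine ⟨C, hC, fun ε hε h hh => ?_⟩
  have hpair : Measurable fun x : Fin n → EuclideanSpace ℝ (Fin 2) => h (x i) (x j) :=
    Measurable.comp (g := Function.uncurry h) (f := fun x : Fin n → _ => (x i, x j)) hh
      (by fun_prop)
  have hk : Measurable (Function.uncurry fun a b => mollSigma 2 ε (a - b) * h a b) :=
    ((measurable_mollSigma 2 ε).comp (measurable_fst.sub measurable_snd)).mul hh
  have hmeas : Measurable fun x => graphKernel G ε x * h (x i) (x j) :=
    (measurable_graphKernel ε).mul hpair
  have hinner : ∫⋯∫⁻_s, (fun x => graphKernel G ε x * h (x i) (x j)) ∂(fun _ => volume) ≤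
      fun x => C * (mollSigma 2 ε (x i - x j) * h (x i) (x j)) := by
    intro x
    have hxi : ∀ z, Function.updateFinset x s z i = x i := fun z => by
      simp [Function.updateFinset, hi]
    have hxj : ∀ z, Function.updateFinset x s z j = x j := fun z => by
      simp [Function.updateFinset, hj]
    calc ∫⁻ z, graphKernel G ε (Function.updateFinset x s z) *
            h (Function.updateFinset x s z i) (Function.updateFinset x s z j)
              ∂(Measure.pi fun _ => volume)
        = (∫⁻ z : s → EuclideanSpace ℝ (Fin 2), graphKernel G ε (Function.updateFinset x s z)) *
            h (x i) (x j) := by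
          simp only [hxi, hxj]
          exact lintegral_mul_const _ ((measurable_graphKernel ε).comp measurable_updateFinset)
      _ ≤ C * mollSigma 2 ε (x i - x j) * h (x i) (x j) := by
          gcongr
          exact lintegral_graphKernel_updateFinset_le hmem hi hj hε x (hvol ε hε x)
      _ = C * (mollSigma 2 ε (x i - x j) * h (x i) (x j)) := mul_assoc _ _ _
  have hsplit : (Finset.univ : Finset (Fin n)) = insert i {j} ∪ s := by
    rw [hsdef]
    exact (Finset.union_sdiff_of_subset (Finset.subset_univ _)).symm
  calc ∫⁻ x, graphKernel G ε x * h (x i) (x j)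
      = (∫⋯∫⁻_insert i {j}, ∫⋯∫⁻_s, (fun x => graphKernel G ε x * h (x i) (x j))
          ∂(fun _ => volume) ∂(fun _ => volume)) 0 := by
        rw [← lmarginal_union _ _ hmeas (hsdef ▸ Finset.disjoint_sdiff), ← hsplit]
        exact lintegral_eq_lmarginal_univ 0
    _ ≤ (∫⋯∫⁻_insert i {j}, (fun x : Fin n → EuclideanSpace ℝ (Fin 2) =>
            C * (mollSigma 2 ε (x i - x j) * h (x i) (x j)))
          ∂(fun _ => volume)) 0 := lmarginal_mono hinner 0
    _ = ∫⁻ a, ∫⁻ b, C * (mollSigma 2 ε (a - b) * h a b) :=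
        lmarginal_insert_singleton (h := fun a b => C * (mollSigma 2 ε (a - b) * h a b)) hij.ne
          (hk.const_mul C) 0
    _ = C * ∫⁻ a, ∫⁻ b, mollSigma 2 ε (a - b) * h a b :=
        lintegral_lintegral_const_mul (h := fun a b => mollSigma 2 ε (a - b) * h a b) hk C

end Kernel

section Interpolation

lemma nnLpNorm'_inv_ofReal {d : ℕ} {t : ℝ} (ht : 0 < t) (f : EuclideanSpace ℝ (Fin d) → ℝ≥0) :
    nnLpNorm' (ENNReal.ofReal t)⁻¹ f = (∫⁻ x, (f x : ℝ≥0∞) ^ (1 / t)) ^ t := by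
  unfold nnLpNorm'
  rw [eLpNorm_eq_lintegral_rpow_enorm_toReal (by simp) (by simpa using ht)]
  simp [ENNReal.toReal_inv, ENNReal.toReal_ofReal ht.le]

lemma ae_le_nnLpNorm'_top {d : ℕ} (f : EuclideanSpace ℝ (Fin d) → ℝ≥0) :
    ∀ᵐ x, (f x : ℝ≥0∞) ≤ nnLpNorm' ∞ f := by
  filter_upwards [ae_le_eLpNormEssSup (f := fun x => (f x : ℝ)) (μ := volume)] with x hx
  simpa [nnLpNorm'] using hx

lemma nnLpNorm'_rpow_div_le {d : ℕ} {a b : ℝ} (ha : 0 < a) (hb : 0 ≤ b)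
    (f : EuclideanSpace ℝ (Fin d) → ℝ≥0) :
    nnLpNorm' (ENNReal.ofReal b)⁻¹ (fun x => f x ^ (b / a)) ≤
      nnLpNorm' (ENNReal.ofReal a)⁻¹ f ^ (b / a) := by
  rcases hb.eq_or_lt with rfl | hb
  · simp only [zero_div, NNReal.rpow_zero, ENNReal.rpow_zero, ENNReal.ofReal_zero, ENNReal.inv_zero]
    refine (eLpNorm_exponent_top (f := fun _ => ((1 : ℝ≥0) : ℝ)) (μ := volume)).le.trans ?_
    exact eLpNormEssSup_le_of_ae_enorm_bound (by simp)
  · rw [nnLpNorm'_inv_ofReal hb, nnLpNorm'_inv_ofReal ha, ← ENNReal.rpow_mul,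
      mul_div_cancel₀ _ ha.ne']
    refine le_of_eq (congrArg (· ^ b) (lintegral_congr fun x => ?_))
    rw [ENNReal.coe_rpow_of_nonneg _ (by positivity : 0 ≤ b / a), ← ENNReal.rpow_mul]
    congr 1
    field_simp

variable {n : ℕ} {G : SimpleGraph (Fin n)}

/-- The exponents `a` for which the regularized forms are bounded uniformly in `ε`. -/
def IsGoodExponent (G : SimpleGraph (Fin n)) (a : Fin n → ℝ) : Prop :=
  (∀ i, 0 ≤ a i) ∧ ∃ C : ℝ≥0∞, C ≠ ∞ ∧ ∀ ε ∈ Ioo (0 : ℝ) 1,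
    ∀ f : Fin n → EuclideanSpace ℝ (Fin 2) → ℝ≥0, (∀ i, Measurable (f i)) →
      lamEps G ε f ≤ C * ∏ i, nnLpNorm' (ENNReal.ofReal (a i))⁻¹ (f i)

lemma exists_conjugate_powers {s t b c : ℝ} (hs : 0 < s) (ht : 0 < t) (hst : s + t = 1)
    (hb : 0 ≤ b) (hc : 0 ≤ c) : ∃ p q : ℝ, 0 ≤ p ∧ 0 ≤ q ∧ p * s + q * t = 1 ∧
      ∀ f : EuclideanSpace ℝ (Fin 2) → ℝ≥0,
        nnLpNorm' (ENNReal.ofReal b)⁻¹ (fun x => f x ^ p) ≤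
            nnLpNorm' (ENNReal.ofReal (s * b + t * c))⁻¹ f ^ p ∧
          nnLpNorm' (ENNReal.ofReal c)⁻¹ (fun x => f x ^ q) ≤
            nnLpNorm' (ENNReal.ofReal (s * b + t * c))⁻¹ f ^ q := by
  have hsb := mul_nonneg hs.le hb
  have htc := mul_nonneg ht.le hc
  rcases (add_nonneg hsb htc).eq_or_lt with h | h
  · have hb0 : b = 0 := by nlinarith
    have hc0 : c = 0 := by nlinarith
    refine ⟨1, 1, zero_le_one, zero_le_one, by linarith, fun f => ?_⟩
    simp [hb0, hc0]
  · refine ⟨b / (s * b + t * c), c / (s * b + t * c), by positivity, by positivity, ?_,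
      fun f => ⟨nnLpNorm'_rpow_div_le h hb f, nnLpNorm'_rpow_div_le h hc f⟩⟩
    rw [div_mul_eq_mul_div, div_mul_eq_mul_div, ← add_div, mul_comm b, mul_comm c, div_self h.ne']

lemma IsGoodExponent.convex_comb {b c : Fin n → ℝ} (hb : IsGoodExponent G b)
    (hc : IsGoodExponent G c) {s t : ℝ} (hs : 0 < s) (ht : 0 < t) (hst : s + t = 1) :
    IsGoodExponent G (s • b + t • c) := by
  obtain ⟨hb0, B, hB, hb⟩ := hb
  obtain ⟨hc0, C, hC, hc⟩ := hc
  refine ⟨fun i => add_nonneg (mul_nonneg hs.le (hb0 i)) (mul_nonneg ht.le (hc0 i)),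
    B ^ s * C ^ t, by finiteness, fun ε hε f hf => ?_⟩
  choose p q hp hq hpq hN using fun i => exists_conjugate_powers hs ht hst (hb0 i) (hc0 i)
  have hmeas : ∀ r : Fin n → ℝ, Measurable fun x : Fin n → EuclideanSpace ℝ (Fin 2) =>
      graphKernel G ε x * ∏ i, ((f i (x i) ^ r i : ℝ≥0) : ℝ≥0∞) := fun r =>
    (measurable_graphKernel ε).mul <| Finset.measurable_fun_prod _ fun i _ =>
      (((hf i).comp (measurable_pi_apply i)).pow_const (r i)).coe_nnreal_ennreal
  have hsplit : ∀ i x, (f i x : ℝ≥0∞) =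
      ((f i x ^ p i : ℝ≥0) : ℝ≥0∞) ^ s * ((f i x ^ q i : ℝ≥0) : ℝ≥0∞) ^ t := by
    intro i x
    rw [← ENNReal.coe_rpow_of_nonneg _ hs.le, ← ENNReal.coe_rpow_of_nonneg _ ht.le,
      ← ENNReal.coe_mul, ← NNReal.rpow_mul, ← NNReal.rpow_mul,
      ← NNReal.rpow_add_of_nonneg _ (mul_nonneg (hp i) hs.le) (mul_nonneg (hq i) ht.le), hpq,
      NNReal.rpow_one]
  calc lamEps G ε f
      = ∫⁻ x, (graphKernel G ε x * ∏ i, ((f i (x i) ^ p i : ℝ≥0) : ℝ≥0∞)) ^ s *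
          (graphKernel G ε x * ∏ i, ((f i (x i) ^ q i : ℝ≥0) : ℝ≥0∞)) ^ t := by
        refine lintegral_congr fun x => ?_
        change graphKernel G ε x * _ = _
        rw [ENNReal.mul_rpow_of_nonneg _ _ hs.le, ENNReal.mul_rpow_of_nonneg _ _ ht.le,
          mul_mul_mul_comm, ← ENNReal.rpow_add_of_nonneg _ _ hs.le ht.le, hst, ENNReal.rpow_one,
          ← ENNReal.prod_rpow_of_nonneg hs.le, ← ENNReal.prod_rpow_of_nonneg ht.le,
          ← Finset.prod_mul_distrib]
        simp only [← hsplit]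
    _ ≤ lamEps G ε (fun i x => f i x ^ p i) ^ s * lamEps G ε (fun i x => f i x ^ q i) ^ t :=
        ENNReal.lintegral_mul_norm_pow_le (hmeas p).aemeasurable (hmeas q).aemeasurable hs.le ht.le
          hst
    _ ≤ (B * ∏ i, nnLpNorm' (ENNReal.ofReal ((s • b + t • c) i))⁻¹ (f i) ^ p i) ^ s *
          (C * ∏ i, nnLpNorm' (ENNReal.ofReal ((s • b + t • c) i))⁻¹ (f i) ^ q i) ^ t := by
        gcongr
        · refine (hb ε hε _ fun i => (hf i).pow_const _).trans ?_
          gcongr with i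
          exact (hN i (f i)).1
        · refine (hc ε hε _ fun i => (hf i).pow_const _).trans ?_
          gcongr with i
          exact (hN i (f i)).2
    _ = _ := by
        rw [ENNReal.mul_rpow_of_nonneg _ _ hs.le, ENNReal.mul_rpow_of_nonneg _ _ ht.le,
          mul_mul_mul_comm, ← ENNReal.prod_rpow_of_nonneg hs.le,
          ← ENNReal.prod_rpow_of_nonneg ht.le, ← Finset.prod_mul_distrib]
        congr 1
        refine Finset.prod_congr rfl fun i _ => ?_
        rw [← ENNReal.rpow_mul, ← ENNReal.rpow_mul,
          ← ENNReal.rpow_add_of_nonneg _ _ (mul_nonneg (hp i) hs.le) (mul_nonneg (hq i) ht.le), hpq,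
          ENNReal.rpow_one]

end Interpolation

section Corners

variable {n : ℕ} {G : SimpleGraph (Fin n)} [Fintype G.edgeSet]

lemma exists_lamEps_le_pair (hconn : G.Connected) (hreg : RegularlyRealizable G) {i j : Fin n}
    (hij : G.Adj i j) :
    ∃ C : ℝ≥0∞, C ≠ ∞ ∧ ∀ ε ∈ Ioo (0 : ℝ) 1,
      ∀ f : Fin n → EuclideanSpace ℝ (Fin 2) → ℝ≥0, (∀ k, Measurable (f k)) →
        lamEps G ε f ≤ C * (∏ k ∈ Finset.univ \ {i, j}, nnLpNorm' ∞ (f k)) *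
          ∫⁻ a, ∫⁻ b, mollSigma 2 ε (a - b) * (f i a * f j b) := by
  obtain ⟨C, hC, h⟩ := exists_lintegral_graphKernel_mul_le hconn hreg hij
  refine ⟨C, hC, fun ε hε f hf => ?_⟩
  set P := ∏ k ∈ Finset.univ \ {i, j}, nnLpNorm' ∞ (f k)
  have hae : ∀ᵐ x : Fin n → EuclideanSpace ℝ (Fin 2), ∀ k, (f k (x k) : ℝ≥0∞) ≤ nnLpNorm' ∞ (f k) :=
    ae_all_iff.2 fun k => (Measure.tendsto_eval_ae_ae
      (μ := fun _ : Fin n => (volume : Measure (EuclideanSpace ℝ (Fin 2))))).eventually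
        (ae_le_nnLpNorm'_top (f k))
  have hfm : ∀ k, Measurable fun a => (f k a : ℝ≥0∞) := fun k => (hf k).coe_nnreal_ennreal
  have hpair : Measurable (Function.uncurry fun a b => (f i a * f j b : ℝ≥0∞)) :=
    ((hfm i).comp measurable_fst).mul ((hfm j).comp measurable_snd)
  have hkm : Measurable fun x : Fin n → EuclideanSpace ℝ (Fin 2) =>
      graphKernel G ε x * (f i (x i) * f j (x j) : ℝ≥0∞) :=
    (measurable_graphKernel ε).mul
      (((hfm i).comp (measurable_pi_apply i)).mul ((hfm j).comp (measurable_pi_apply j)))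
  calc lamEps G ε f
      ≤ ∫⁻ x, P * (graphKernel G ε x * (f i (x i) * f j (x j))) := by
        refine lintegral_mono_ae ?_
        filter_upwards [hae] with x hx
        change graphKernel G ε x * _ ≤ _
        rw [← Finset.prod_sdiff (Finset.subset_univ {i, j}), Finset.prod_pair hij.ne,
          mul_left_comm]
        gcongr
        exact Finset.prod_le_prod' fun k _ => hx k
    _ = P * ∫⁻ x, graphKernel G ε x * (f i (x i) * f j (x j)) := lintegral_const_mul _ hkm
    _ ≤ P * (C * ∫⁻ a, ∫⁻ b, mollSigma 2 ε (a - b) * (f i a * f j b)) := by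
        gcongr
        exact h ε hε (fun a b => f i a * f j b) hpair
    _ = _ := by ring

lemma isGoodExponent_pair (hconn : G.Connected) (hreg : RegularlyRealizable G) {i j : Fin n}
    (hij : G.Adj i j) :
    IsGoodExponent G ((2 / 3 : ℝ) • (Pi.single i 1 : Fin n → ℝ) +
      (2 / 3 : ℝ) • (Pi.single j 1 : Fin n → ℝ)) := by
  obtain ⟨C, hC, h⟩ := exists_lamEps_le_pair hconn hreg hij
  set a : Fin n → ℝ := (2 / 3 : ℝ) • (Pi.single i 1 : Fin n → ℝ) +
    (2 / 3 : ℝ) • (Pi.single j 1 : Fin n → ℝ) with ha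
  have hai : a i = 2 / 3 := by simp [ha, hij.ne]
  have haj : a j = 2 / 3 := by simp [ha, hij.ne']
  have hak : ∀ k ∈ Finset.univ \ {i, j}, a k = 0 := fun k hk => by
    simp only [Finset.mem_sdiff, Finset.mem_insert, Finset.mem_singleton, not_or] at hk
    simp [ha, hk.2.1, hk.2.2]
  refine ⟨fun k => ?_, C * 720, by finiteness, fun ε hε f hf => ?_⟩
  · by_cases hk : k ∈ Finset.univ \ {i, j}
    · exact (hak k hk).ge
    · have : k = i ∨ k = j := by simpa [or_iff_not_imp_left] using hk
      rcases this with rfl | rfl <;> norm_num [hai, haj]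
  · rw [← Finset.prod_sdiff (Finset.subset_univ {i, j}), Finset.prod_pair hij.ne, hai, haj,
      Finset.prod_congr rfl fun k hk => by rw [hak k hk, ENNReal.ofReal_zero, ENNReal.inv_zero],
      nnLpNorm'_inv_ofReal (by norm_num), nnLpNorm'_inv_ofReal (by norm_num)]
    have hb := isPairBound_mollSigma hε (fun x => f i x) (fun x => f j x)
      (hf i).coe_nnreal_ennreal (hf j).coe_nnreal_ennreal
    refine (h ε hε f hf).trans ((mul_le_mul_right hb _).trans_eq ?_)
    rw [show (1 / (2 / 3) : ℝ) = 3 / 2 by norm_num]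
    ring

lemma lintegral_mollSigma_mul_le {ε : ℝ} (hε : ε ∈ Ioo (0 : ℝ) 1)
    {f g : EuclideanSpace ℝ (Fin 2) → ℝ≥0} (hf : Measurable f) :
    ∫⁻ a, ∫⁻ b, mollSigma 2 ε (a - b) * (f a * g b) ≤
      ENNReal.ofReal (2 * Real.pi) * ((∫⁻ a, f a) * nnLpNorm' ∞ g) := by
  calc ∫⁻ a, ∫⁻ b, mollSigma 2 ε (a - b) * (f a * g b)
      ≤ ∫⁻ a, ∫⁻ b, (f a * nnLpNorm' ∞ g) * mollSigma 2 ε (a - b) := by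
        refine lintegral_mono fun a => lintegral_mono_ae ?_
        filter_upwards [ae_le_nnLpNorm'_top g] with b hb
        rw [mul_comm]
        gcongr
    _ = ∫⁻ a, (f a * nnLpNorm' ∞ g) * ∫⁻ z, mollSigma 2 ε z := by
        refine lintegral_congr fun a => ?_
        have hσ : Measurable fun b => mollSigma 2 ε (a - b) :=
          (measurable_mollSigma 2 ε).comp (by fun_prop)
        rw [lintegral_const_mul _ hσ, lintegral_sub_left_eq_self (mollSigma 2 ε)]
    _ = (∫⁻ a, f a) * nnLpNorm' ∞ g * ∫⁻ z, mollSigma 2 ε z := by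
        rw [lintegral_mul_const _ (hf.coe_nnreal_ennreal.mul_const _),
          lintegral_mul_const _ hf.coe_nnreal_ennreal]
    _ ≤ (∫⁻ a, f a) * nnLpNorm' ∞ g * ENNReal.ofReal (2 * Real.pi) := by
        gcongr
        exact lintegral_mollSigma_le hε
    _ = _ := mul_comm _ _

lemma isGoodExponent_single (hn : 2 ≤ n) (hconn : G.Connected) (hreg : RegularlyRealizable G)
    (i : Fin n) : IsGoodExponent G (Pi.single i 1) := by
  have : Nontrivial (Fin n) := Fin.nontrivial_iff_two_le.2 hn
  obtain ⟨j, hij⟩ := hconn.preconnected.exists_adj_of_nontrivial i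
  obtain ⟨C, hC, h⟩ := exists_lamEps_le_pair hconn hreg hij
  refine ⟨fun k => (Pi.single_nonneg (α := fun _ : Fin n => ℝ)).2 zero_le_one k,
    C * ENNReal.ofReal (2 * Real.pi), by finiteness,
    fun ε hε f hf => ?_⟩
  have hak : ∀ k ∈ Finset.univ \ {i, j}, (Pi.single i 1 : Fin n → ℝ) k = 0 := fun k hk => by
    simp only [Finset.mem_sdiff, Finset.mem_insert, Finset.mem_singleton, not_or] at hk
    simp [hk.2.1]
  rw [← Finset.prod_sdiff (Finset.subset_univ {i, j}), Finset.prod_pair hij.ne,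
    Finset.prod_congr rfl fun k hk => by rw [hak k hk, ENNReal.ofReal_zero, ENNReal.inv_zero],
    Pi.single_eq_same, Pi.single_eq_of_ne hij.ne', ENNReal.ofReal_zero, ENNReal.inv_zero,
    nnLpNorm'_inv_ofReal one_pos]
  refine (h ε hε f hf).trans
    ((mul_le_mul_right (lintegral_mollSigma_mul_le hε (hf i)) _).trans_eq ?_)
  simp only [div_one, ENNReal.rpow_one]
  ring

end Corners

end

/-- **All regularly realizable graphs are good.** If `G` is a connected graph on `n ≥ 2`
vertices which is regularly realizable in `ℝ²`, and `(a₁,…,aₙ)` lies in the convex hull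
of `{e_i} ∪ {(2/3)e_i + (2/3)e_j : {i,j} ∈ E}`, then the regularized forms `Λ_G^ε` are
bounded on `L^{1/a₁} × ⋯ × L^{1/aₙ}` uniformly in `ε ∈ (0,1)`. -/
theorem regularly_realizable_graphs_good {n : ℕ} (hn : 2 ≤ n)
    (G : SimpleGraph (Fin n)) [Fintype G.edgeSet] (hconn : G.Connected)
    (hreg : RegularlyRealizable G)
    (a : Fin n → ℝ) (ha : a ∈ convexHull ℝ (cornerSet G)) :
    ∃ C : ℝ, 0 < C ∧ ∀ ε : ℝ, ε ∈ Set.Ioo (0:ℝ) 1 →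
      ∀ f : Fin n → EuclideanSpace ℝ (Fin 2) → ℝ≥0, (∀ i, Measurable (f i)) →
        lamEps G ε f ≤ ENNReal.ofReal C * ∏ i, nnLpNorm' (ENNReal.ofReal (a i))⁻¹ (f i) := by
  have hcorner : cornerSet G ⊆ {a | IsGoodExponent G a} := by
    rintro _ (⟨i, rfl⟩ | ⟨i, j, hij, rfl⟩)
    · exact isGoodExponent_single hn hconn hreg i
    · exact isGoodExponent_pair hconn hreg hij
  have hconv : Convex ℝ {a | IsGoodExponent G a} :=
    convex_iff_forall_pos.2 fun _ hb _ hc _ _ hs ht hst =>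
      IsGoodExponent.convex_comb hb hc hs ht hst
  obtain ⟨-, C, hC, h⟩ := convexHull_min hcorner hconv ha
  refine ⟨C.toReal + 1, by positivity, fun ε hε f hf => (h ε hε f hf).trans ?_⟩
  gcongr
  rw [← ENNReal.ofReal_toReal hC]
  exact ENNReal.ofReal_le_ofReal (by rw [ENNReal.ofReal_toReal hC]; linarith)
end
end

section
/- Let G be a connected simple graph on vertices {1,…,n}, n ≥ 2, with edge set E, which is regularly realizable in ℝ². Then the singular kernel ∏_{{i,j}∈E} σ(x^i − x^j) is locally integrable in the uniform ε-regularized sense: for every bounded measurable set B ⊂ ℝ², sup_{ε∈(0,1)} ∫_{B^n} ∏_{{i,j}∈E, i<j} σ_ε(x^i − x^j) dx^1 ⋯ dx^n < ∞. -/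
open MeasureTheory ENNReal NNReal

noncomputable section

section LevelSets

variable {V W : Type*} [NormedAddCommGroup V] [NormedSpace ℝ V] [FiniteDimensional ℝ V]
  [MeasurableSpace V] [BorelSpace V] [NormedAddCommGroup W] [NormedSpace ℝ W]
  [FiniteDimensional ℝ W]

/-- The part of the unit ball that a surjective linear map sends into a ball of radius `r` has
measure `O(r ^ dim W)`. -/
theorem ContinuousLinearMap.exists_measure_unitBall_inter_preimage_le (μ : Measure V)
    [μ.IsAddHaarMeasure] (A : V →L[ℝ] W) (hA : Function.Surjective A) :
    ∃ C : ℝ≥0∞, C ≠ ⊤ ∧ ∀ r : ℝ, 0 < r →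
      μ {z | ‖z‖ ≤ 1 ∧ ‖A z‖ ≤ r} ≤ C * ENNReal.ofReal (r ^ Module.finrank ℝ W) := by
  borelize W
  let ν : Measure W := Measure.addHaar
  obtain ⟨s, hs⟩ := A.exists_rightInverse_of_surjective (LinearMap.range_eq_top.2 hA)
  have hs' : ∀ u, A (s u) = u := fun u => by simpa using DFunLike.congr_fun hs u
  set D := Metric.closedBall (0 : V) (1 + ‖s‖) with hD
  set U := Metric.closedBall (0 : W) 1
  have hU0 : ν U ≠ 0 := (Metric.measure_closedBall_pos ν 0 one_pos).ne'
  have hUt : ν U ≠ ⊤ := measure_closedBall_lt_top.ne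
  have hDt : μ D ≠ ⊤ := measure_closedBall_lt_top.ne
  refine ⟨μ D, hDt, fun r hr => ?_⟩
  set S : Set V := {z | ‖z‖ ≤ 1 ∧ ‖A z‖ ≤ r}
  have hSm : MeasurableSet S :=
    ((isClosed_le continuous_norm continuous_const).inter
      (isClosed_le A.continuous.norm continuous_const)).measurableSet
  have key : ν U * μ S ≤ μ D * (ENNReal.ofReal (r ^ Module.finrank ℝ W) * ν U) := by
    calc ν U * μ S
        = ∫⁻ u in U, ∫⁻ z, S.indicator 1 (z - s u) ∂μ ∂ν := by
          simp_rw [lintegral_sub_right_eq_self (S.indicator 1), lintegral_indicator_one hSm]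
          simp [mul_comm]
      _ = ∫⁻ z, ∫⁻ u in U, S.indicator 1 (z - s u) ∂ν ∂μ := by
          apply lintegral_lintegral_swap
          have : Measurable fun p : W × V => p.2 - s p.1 := by fun_prop
          exact ((measurable_one.indicator hSm).comp this).aemeasurable
      _ ≤ ∫⁻ z, D.indicator (fun _ => ENNReal.ofReal (r ^ Module.finrank ℝ W) * ν U) z ∂μ := by
          refine lintegral_mono fun z => ?_
          by_cases hz : z ∈ D
          · rw [Set.indicator_of_mem hz, ← Measure.addHaar_closedBall' ν (A z) hr.le,
              ← lintegral_indicator_one Metric.isClosed_closedBall.measurableSet]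
            refine (setLIntegral_le_lintegral _ _).trans (lintegral_mono fun u => ?_)
            by_cases hu : z - s u ∈ S
            · have hu' : u ∈ Metric.closedBall (A z) r := by
                rw [Metric.mem_closedBall, dist_comm, dist_eq_norm]
                simpa [hs'] using hu.2
              simp [hu, hu']
            · simp [hu]
          · rw [Set.indicator_of_notMem hz, nonpos_iff_eq_zero,
              setLIntegral_eq_zero Metric.isClosed_closedBall.measurableSet]
            intro u hu
            refine Set.indicator_of_notMem (fun h => hz ?_) _
            rw [mem_closedBall_zero_iff] at hu
            rw [hD, mem_closedBall_zero_iff]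
            calc ‖z‖ = ‖(z - s u) + s u‖ := by simp
              _ ≤ ‖z - s u‖ + ‖s u‖ := norm_add_le _ _
              _ ≤ 1 + ‖s‖ := add_le_add h.1 (s.unit_le_opNorm u hu)
      _ = _ := by
          rw [lintegral_indicator_const Metric.isClosed_closedBall.measurableSet, mul_comm]
  rw [← ENNReal.mul_le_mul_iff_right hU0 hUt]
  calc _ ≤ _ := key
    _ = _ := by ring

/-- Near a point where `f` is a submersion, the preimages of balls of radius `r` have
measure `O(r ^ dim W)`. -/
theorem HasStrictFDerivAt.exists_measure_inter_preimage_closedBall_le (μ : Measure V)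
    [μ.IsAddHaarMeasure] {f : V → W} {A : V →L[ℝ] W} {a : V} (hf : HasStrictFDerivAt f A a)
    (hA : Function.Surjective A) :
    ∃ t ∈ nhds a, ∃ C : ℝ≥0∞, C ≠ ⊤ ∧ ∀ r : ℝ, 0 < r →
      μ (t ∩ f ⁻¹' Metric.closedBall (f a) r) ≤ C * ENNReal.ofReal (r ^ Module.finrank ℝ W) := by
  obtain ⟨s, hs⟩ := A.exists_rightInverse_of_surjective (LinearMap.range_eq_top.2 hA)
  have hs' : ∀ u, A (s u) = u := fun u => by simpa using DFunLike.congr_fun hs u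
  obtain ⟨C, hC, hCr⟩ := A.exists_measure_unitBall_inter_preimage_le μ hA
  let g : V → V := fun x => (x - a) + s (f x - f a - A (x - a))
  have hAg : ∀ x, A (g x) = f x - f a := fun x => by simp [g, hs']
  have hga : g a = 0 := by simp [g]
  have hg : HasStrictFDerivAt g (ContinuousLinearMap.id ℝ V) a := by
    have h1 : HasStrictFDerivAt (fun x : V => x - a) (ContinuousLinearMap.id ℝ V) a :=
      (hasStrictFDerivAt_id a).sub_const a
    have h2 := h1.fun_add (s.hasStrictFDerivAt.comp a
      ((hf.sub_const (f a)).fun_sub (A.hasStrictFDerivAt.comp a h1)))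
    simpa [g] using h2
  have hdet : ((1 / 2 : ℝ≥0) : ℝ≥0∞) <
      ENNReal.ofReal |(ContinuousLinearMap.id ℝ V).det| := by
    have : (ContinuousLinearMap.id ℝ V).det = 1 := by
      simp [ContinuousLinearMap.det]
    rw [this]
    simp
  obtain ⟨δ, hδ, hδ0⟩ := ((mul_le_addHaar_image_of_lt_det μ _ hdet).and
    self_mem_nhdsWithin).exists
  obtain ⟨t, ht, hgt⟩ := hg.approximates_deriv_on_nhds (Or.inr hδ0)
  have hball : g ⁻¹' Metric.closedBall 0 1 ∈ nhds a :=
    hg.continuousAt.preimage_mem_nhds (by rw [hga]; exact Metric.closedBall_mem_nhds _ one_pos)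
  refine ⟨_, Filter.inter_mem ht hball, 2 * C, ENNReal.mul_ne_top (by simp) hC, fun r hr => ?_⟩
  set T := t ∩ g ⁻¹' Metric.closedBall 0 1 ∩ f ⁻¹' Metric.closedBall (f a) r
  have h1 := hδ T g (hgt.mono_set fun x hx => hx.1.1)
  have h2 : g '' T ⊆ {z | ‖z‖ ≤ 1 ∧ ‖A z‖ ≤ r} := by
    rintro _ ⟨x, hx, rfl⟩
    refine ⟨by simpa using hx.1.2, ?_⟩
    rw [hAg, ← dist_eq_norm]
    exact hx.2
  have h3 := (h1.trans (measure_mono h2)).trans (hCr r hr)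
  calc μ T = 2 * (((1 / 2 : ℝ≥0) : ℝ≥0∞) * μ T) := by
        rw [← mul_assoc]
        have : (2 : ℝ≥0∞) * ((1 / 2 : ℝ≥0) : ℝ≥0∞) = 1 := by
          rw [← ENNReal.coe_ofNat, ← ENNReal.coe_mul]; norm_num
        rw [this, one_mul]
    _ ≤ 2 * (C * ENNReal.ofReal (r ^ Module.finrank ℝ W)) := by gcongr
    _ = _ := by ring

/-- If `w` is a regular value of `f` along the compact set `K`, then the preimages in `K` of the
balls of radius `r` around `w` have measure `O(r ^ dim W)`. -/
theorem IsCompact.exists_measure_inter_preimage_closedBall_le (μ : Measure V)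
    [μ.IsAddHaarMeasure] {f : V → W} (hf : Continuous f) {w : W} {K : Set V} (hK : IsCompact K)
    (hreg : ∀ x ∈ K, f x = w → ∃ A : V →L[ℝ] W, HasStrictFDerivAt f A x ∧ Function.Surjective A) :
    ∃ C : ℝ≥0∞, C ≠ ⊤ ∧ ∀ r : ℝ, 0 < r →
      μ (K ∩ f ⁻¹' Metric.closedBall w r) ≤ C * ENNReal.ofReal (r ^ Module.finrank ℝ W) := by
  refine hK.induction_on (p := fun K => ∃ C : ℝ≥0∞, C ≠ ⊤ ∧ ∀ r : ℝ, 0 < r →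
      μ (K ∩ f ⁻¹' Metric.closedBall w r) ≤ C * ENNReal.ofReal (r ^ Module.finrank ℝ W))
    ⟨0, by simp⟩ ?_ ?_ fun x hx => ?_
  · rintro s t hst ⟨C, hC, h⟩
    exact ⟨C, hC, fun r hr =>
      (measure_mono (Set.inter_subset_inter_left _ hst)).trans (h r hr)⟩
  · rintro s t ⟨C, hC, h⟩ ⟨C', hC', h'⟩
    refine ⟨C + C', ENNReal.add_ne_top.2 ⟨hC, hC'⟩, fun r hr => ?_⟩
    rw [Set.union_inter_distrib_right, add_mul]
    exact (measure_union_le _ _).trans (add_le_add (h r hr) (h' r hr))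
  by_cases hxw : f x = w
  · obtain ⟨A, hfA, hA⟩ := hreg x hx hxw
    obtain ⟨t, ht, h⟩ := hfA.exists_measure_inter_preimage_closedBall_le μ hA
    exact ⟨t, mem_nhdsWithin_of_mem_nhds ht, hxw ▸ h⟩
  · have hd : 0 < dist (f x) w := dist_pos.2 hxw
    set δ := dist (f x) w / 2
    have hδ0 : 0 < δ := half_pos hd
    have hopen : IsOpen {y | δ < dist (f y) w} :=
      isOpen_lt continuous_const (hf.dist continuous_const)
    refine ⟨{y | δ < dist (f y) w} ∩ Metric.closedBall x 1, mem_nhdsWithin_of_mem_nhds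
      (Filter.inter_mem (hopen.mem_nhds (half_lt_self hd)) (Metric.closedBall_mem_nhds x one_pos)),
      μ (Metric.closedBall x 1) * (ENNReal.ofReal (δ ^ Module.finrank ℝ W))⁻¹,
      ENNReal.mul_ne_top measure_closedBall_lt_top.ne
        (ENNReal.inv_ne_top.2 (by simpa using pow_pos hδ0 _)), fun r hr => ?_⟩
    rcases lt_or_ge r δ with hrδ | hrδ
    · have : {y | δ < dist (f y) w} ∩ Metric.closedBall x 1 ∩ f ⁻¹' Metric.closedBall w r = ∅ := by
        ext y
        simp only [Set.mem_inter_iff, Set.mem_ofPred_eq, Set.mem_preimage, Metric.mem_closedBall,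
          Set.mem_empty_iff_false, iff_false, not_and, not_le]
        exact fun h => hrδ.trans h.1
      simp [this]
    · calc _ ≤ μ (Metric.closedBall x 1) := measure_mono fun y hy => hy.1.2
        _ = μ (Metric.closedBall x 1) * ((ENNReal.ofReal (δ ^ Module.finrank ℝ W))⁻¹ *
              ENNReal.ofReal (δ ^ Module.finrank ℝ W)) := by
            rw [ENNReal.inv_mul_cancel (by simpa using pow_pos hδ0 _) ENNReal.ofReal_ne_top,
              mul_one]
        _ ≤ _ := by rw [← mul_assoc]; gcongr

end LevelSets

theorem continuous_distMap_s6 {n : ℕ} (G : SimpleGraph (Fin n)) [Fintype G.edgeSet] :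
    Continuous (distMap G) := by
  refine continuous_pi fun ⟨e, he⟩ => ?_
  induction e with
  | _ i j =>
    exact Continuous.dist (f := fun x : Fin n → EuclideanSpace ℝ (Fin 2) => x i)
      (continuous_apply i) (continuous_apply j)

theorem RegularlyRealizable.exists_hasStrictFDerivAt {n : ℕ} {G : SimpleGraph (Fin n)}
    [Fintype G.edgeSet] (hreg : RegularlyRealizable G)
    {x : Fin n → EuclideanSpace ℝ (Fin 2)} (hx : distMap G x = fun _ => 1) :
    ∃ A : (Fin n → EuclideanSpace ℝ (Fin 2)) →L[ℝ] (G.edgeSet → ℝ),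
      HasStrictFDerivAt (distMap G) A x ∧ Function.Surjective A := by
  refine ⟨_, ContDiffAt.hasStrictFDerivAt (n := 1) ?_ one_ne_zero, (hreg.2 x hx).2⟩
  refine contDiffAt_pi.2 fun ⟨e, he⟩ => ?_
  have h1 := congrFun hx ⟨e, he⟩
  induction e with
  | _ i j =>
    have hij : dist (x i) (x j) = 1 := h1
    refine ContDiffAt.dist ℝ (f := fun x : Fin n → EuclideanSpace ℝ (Fin 2) => x i)
      (g := fun x => x j) (contDiff_apply _ _ i).contDiffAt (contDiff_apply _ _ j).contDiffAt ?_
    exact dist_pos.1 (hij ▸ one_pos)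

open Classical in
/-- The regularized kernel is at most `(2ε)^{-|E|}` times the indicator of the set where all the
edges have length in `[1 - ε, 1 + ε]`. -/
theorem prod_mollSigma_le {n : ℕ} (G : SimpleGraph (Fin n)) [Fintype G.edgeSet] {ε : ℝ}
    (hε : 0 < ε) (x : Fin n → EuclideanSpace ℝ (Fin 2)) :
    (∏ i, ∏ j, if i < j ∧ G.Adj i j then mollSigma 2 ε (x i - x j) else 1) ≤
      (distMap G ⁻¹' Metric.closedBall (fun _ => 1) ε).indicator
        (fun _ => ENNReal.ofReal (1 / (2 * ε)) ^ Fintype.card G.edgeSet) x := by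
  by_cases hx : x ∈ distMap G ⁻¹' Metric.closedBall (fun _ => 1) ε
  · rw [Set.indicator_of_mem hx, ← Finset.prod_product', ← Finset.prod_filter]
    have hcard : (Finset.univ.filter fun p : Fin n × Fin n => p.1 < p.2 ∧ G.Adj p.1 p.2).card =
        Fintype.card G.edgeSet := by
      refine Finset.card_bij (fun p hp => ⟨s(p.1, p.2), (Finset.mem_filter.1 hp).2.2⟩)
        (fun _ _ => Finset.mem_univ _) ?_ ?_
      · rintro ⟨i, j⟩ hp ⟨k, l⟩ hq h
        simp only [Finset.mem_filter, Finset.mem_univ, true_and] at hp hq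
        rcases Sym2.eq_iff.1 (congrArg Subtype.val h) with ⟨rfl, rfl⟩ | ⟨rfl, rfl⟩
        · rfl
        · exact absurd hp.1 hq.1.asymm
      · rintro ⟨e, he⟩ -
        induction e with
        | _ i j =>
          have hadj : G.Adj i j := he
          rcases lt_or_gt_of_ne hadj.ne with h | h
          · exact ⟨(i, j), by simp [h, hadj], rfl⟩
          · exact ⟨(j, i), by simp [h, hadj.symm], Subtype.ext Sym2.eq_swap⟩
    rw [← hcard, Finset.univ_product_univ]
    refine Finset.prod_le_pow_card _ _ _ fun p _ => ?_
    rw [mollSigma]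
    split_ifs
    · exact le_rfl
    · exact zero_le
  · rw [Set.indicator_of_notMem hx, nonpos_iff_eq_zero]
    rw [Set.mem_preimage, Metric.mem_closedBall, dist_pi_le_iff hε.le] at hx
    push Not at hx
    obtain ⟨⟨e, he⟩, hlt⟩ := hx
    induction e with
    | _ i j =>
      replace hlt : ε < dist (dist (x i) (x j)) 1 := hlt
      have hadj : G.Adj i j := he
      wlog hij : i < j generalizing i j
      · exact this j i hadj.symm (by rwa [dist_comm (x j)]) hadj.symm
          (lt_of_le_of_ne (not_lt.1 hij) hadj.ne')
      refine Finset.prod_eq_zero (Finset.mem_univ i) (Finset.prod_eq_zero (Finset.mem_univ j) ?_)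
      rw [if_pos ⟨hij, hadj⟩, mollSigma, if_neg]
      rintro ⟨h1, h2⟩
      rw [Real.dist_eq, dist_eq_norm] at hlt
      exact hlt.not_ge (abs_le.2 ⟨by linarith, by linarith⟩)

open Classical in
/-- **Uniform local integrability of the kernel.** If the connected graph `G` on `n ≥ 2`
vertices is regularly realizable in `ℝ²`, then for every bounded measurable `B ⊆ ℝ²` the
integrals of the regularized kernels `∏_{{i,j} ∈ E, i<j} σ_ε(x^i − x^j)` over `Bⁿ` are
bounded uniformly in `ε ∈ (0,1)`. -/
theorem regularized_kernel_locally_integrable {n : ℕ} (hn : 2 ≤ n)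
    (G : SimpleGraph (Fin n)) [Fintype G.edgeSet] (hconn : G.Connected)
    (hreg : RegularlyRealizable G) :
    ∀ B : Set (EuclideanSpace ℝ (Fin 2)), Bornology.IsBounded B → MeasurableSet B →
      (⨆ ε ∈ Set.Ioo (0:ℝ) 1,
        ∫⁻ x : Fin n → EuclideanSpace ℝ (Fin 2) in Set.univ.pi (fun _ => B),
          ∏ i, ∏ j, if i < j ∧ G.Adj i j then mollSigma 2 ε (x i - x j) else 1) < ⊤ := by
  intro B hB hBm
  have hK : IsCompact (Set.univ.pi fun _ : Fin n => closure B) :=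
    isCompact_univ_pi fun _ => hB.isCompact_closure
  obtain ⟨C, hC, hCr⟩ := hK.exists_measure_inter_preimage_closedBall_le volume
    (continuous_distMap_s6 G) (w := fun _ => 1) fun x _ hx => hreg.exists_hasStrictFDerivAt hx
  rw [Module.finrank_fintype_fun_eq_card] at hCr
  refine lt_of_le_of_lt (iSup₂_le fun ε hε => ?_) hC.lt_top
  have hS : MeasurableSet (distMap G ⁻¹' Metric.closedBall (fun _ => 1) ε) :=
    (Metric.isClosed_closedBall.preimage (continuous_distMap_s6 G)).measurableSet
  set m := Fintype.card G.edgeSet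
  calc _ ≤ ∫⁻ x in Set.univ.pi fun _ => B,
        (distMap G ⁻¹' Metric.closedBall (fun _ => 1) ε).indicator
          (fun _ => ENNReal.ofReal (1 / (2 * ε)) ^ m) x :=
        lintegral_mono fun x => prod_mollSigma_le G hε.1 x
    _ = ENNReal.ofReal (1 / (2 * ε)) ^ m * volume
        (distMap G ⁻¹' Metric.closedBall (fun _ => 1) ε ∩ Set.univ.pi fun _ => B) := by
        rw [lintegral_indicator_const hS, Measure.restrict_apply hS]
    _ ≤ ENNReal.ofReal (1 / (2 * ε)) ^ m * (C * ENNReal.ofReal (ε ^ m)) := by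
        gcongr
        refine (measure_mono ?_).trans (hCr ε hε.1)
        rw [Set.inter_comm]
        exact Set.inter_subset_inter_left _ (Set.pi_mono fun _ _ => subset_closure)
    _ = C * ENNReal.ofReal ((1 / 2) ^ m) := by
        have hε0 := hε.1
        rw [mul_left_comm, ← ENNReal.ofReal_pow (by positivity),
          ← ENNReal.ofReal_mul (by positivity), ← mul_pow]
        congr 3
        field_simp
    _ ≤ C := by
        refine mul_le_of_le_one_right' ?_
        rw [ENNReal.ofReal_le_one]
        exact pow_le_one₀ (by norm_num) (by norm_num)
end
end
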